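/- Let I = I_even ⊔ I_odd and let Q = (Q_{i,j}(w,z))_{i,j∈I} be a family of skew polynomials satisfying the conditions: Q_{i,j} ∈ A^{i,j}, Q_{i,i} = 0, Q_{i,j}(w,z) = Q_{j,i}(z,w), and Q_{i,j}(−w,z) = Q_{i,j}(w,z) for i ∈ I_odd. Fix for each w ∈ S_n a reduced expression w = s_{i_1}⋯s_{i_ℓ} and set τ_w = τ_{i_1}⋯τ_{i_ℓ} in the quiver Hecke superalgebra R_n(Q). Then { x^a τ_w e(ν) : a ∈ ℤ_{≥0}^n, w ∈ S_n, ν ∈ I^n } is a basis of R_n(Q) as a k-module, where x^a = x_1^{a_1}⋯x_n^{a_n}. -/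

import Mathlib

/-!
STATEMENT 10 (Corollary 3.15 of Kang–Kashiwara–Tsuchioka): for a fixed choice of reduced
expressions `τ_w`, the set `{ x^a τ_w e(ν) }` is a basis of the quiver Hecke superalgebra
`R_n(Q)` as a `k`-module.
-/

namespace QuiverHeckeSuper10

/-- position `a` resp. `a+1` in `{1,…,n}` attached to `a ∈ {1,…,n−1}`. -/
def lo {n : ℕ} (a : Fin (n - 1)) : Fin n := ⟨a, by omega⟩
def hi {n : ℕ} (a : Fin (n - 1)) : Fin n := ⟨(a : ℕ) + 1, by omega⟩

/-- The transposition `s_a = (a, a+1)` of `{1, …, n}`. -/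
def sperm {n : ℕ} (a : Fin (n - 1)) : Equiv.Perm (Fin n) := Equiv.swap (lo a) (hi a)

variable (k : Type) [CommRing k] (I : Type) [Fintype I] [DecidableEq I]
  (podd : I → Bool)

/-- The relation defining the skew polynomial algebra
`A^{i,j} = k⟨w,z⟩/(zw − (−1)^{p(i)p(j)} wz)`; the variable `0` is `w`, the variable `1`
is `z`. -/
inductive ARel2 (i j : I) : FreeAlgebra k (Fin 2) → FreeAlgebra k (Fin 2) → Prop
  | comm : ARel2 i j (FreeAlgebra.ι k (1 : Fin 2) * FreeAlgebra.ι k (0 : Fin 2))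
      (if podd i ∧ podd j then
        -(FreeAlgebra.ι k (0 : Fin 2) * FreeAlgebra.ι k (1 : Fin 2))
      else FreeAlgebra.ι k (0 : Fin 2) * FreeAlgebra.ι k (1 : Fin 2))

/-- The skew polynomial algebra `A^{i,j}`. -/
abbrev A2 (i j : I) := RingQuot (ARel2 k I podd i j)

/-- The projection `k⟨w,z⟩ → A^{i,j}`. -/
noncomputable def mkA2 (i j : I) : FreeAlgebra k (Fin 2) →ₐ[k] A2 k I podd i j :=
  RingQuot.mkAlgHom k (ARel2 k I podd i j)

/-- The relations defining the three-variable skew polynomial algebra on variables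
`x₀, x₁, x₂` of parities `p(i), p(j), p(i)`. -/
inductive ARel3 (i j : I) : FreeAlgebra k (Fin 3) → FreeAlgebra k (Fin 3) → Prop
  | comm (s t : Fin 3) (h : (s : ℕ) < (t : ℕ)) :
      ARel3 i j (FreeAlgebra.ι k t * FreeAlgebra.ι k s)
        (if podd (if s = 1 then j else i) ∧ podd (if t = 1 then j else i) then
          -(FreeAlgebra.ι k s * FreeAlgebra.ι k t)
        else FreeAlgebra.ι k s * FreeAlgebra.ι k t)

/-- The three-variable skew polynomial algebra with variable parities `p(i), p(j), p(i)`. -/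
abbrev A3 (i j : I) := RingQuot (ARel3 k I podd i j)

noncomputable def mkA3 (i j : I) : FreeAlgebra k (Fin 3) →ₐ[k] A3 k I podd i j :=
  RingQuot.mkAlgHom k (ARel3 k I podd i j)

/-- `(w,z) ↦ (z,w)` on `k⟨w,z⟩`. -/
noncomputable def swapWZ : FreeAlgebra k (Fin 2) →ₐ[k] FreeAlgebra k (Fin 2) :=
  FreeAlgebra.lift k fun t : Fin 2 => FreeAlgebra.ι k (if t = 0 then (1 : Fin 2) else 0)

/-- `(w,z) ↦ (−w,z)` on `k⟨w,z⟩`. -/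
noncomputable def negW : FreeAlgebra k (Fin 2) →ₐ[k] FreeAlgebra k (Fin 2) :=
  FreeAlgebra.lift k fun t : Fin 2 =>
    if t = 0 then -FreeAlgebra.ι k (0 : Fin 2) else FreeAlgebra.ι k (1 : Fin 2)

/-- `Q(w,z) ↦ Q(x₂,x₁)` from `k⟨w,z⟩` to the free algebra in `x₀,x₁,x₂`. -/
noncomputable def sub21 : FreeAlgebra k (Fin 2) →ₐ[k] FreeAlgebra k (Fin 3) :=
  FreeAlgebra.lift k fun t : Fin 2 => FreeAlgebra.ι k (if t = 0 then (2 : Fin 3) else 1)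

/-- `Q(w,z) ↦ Q(x₀,x₁)`. -/
noncomputable def sub01 : FreeAlgebra k (Fin 2) →ₐ[k] FreeAlgebra k (Fin 3) :=
  FreeAlgebra.lift k fun t : Fin 2 => FreeAlgebra.ι k (if t = 0 then (0 : Fin 3) else 1)

/-- The conditions (3.1) on the family `Q = (Q_{i,j})`, expressed on representatives
`Qrep i j ∈ k⟨w,z⟩` of `Q_{i,j} ∈ A^{i,j}`:
`Q_{i,i} = 0`, `Q_{i,j}(w,z) = Q_{j,i}(z,w)`, and `Q_{i,j}(−w,z) = Q_{i,j}(w,z)` for odd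
`i`. -/
structure QConds (Qrep : I → I → FreeAlgebra k (Fin 2)) : Prop where
  diag : ∀ i, mkA2 k I podd i i (Qrep i i) = 0
  symm : ∀ i j, mkA2 k I podd i j (swapWZ k (Qrep j i)) = mkA2 k I podd i j (Qrep i j)
  even : ∀ i j, podd i = true →
    mkA2 k I podd i j (negW k (Qrep i j)) = mkA2 k I podd i j (Qrep i j)

/-- Generators of the quiver Hecke superalgebra `R_n(Q)`. -/
inductive RGen (I : Type) (n : ℕ) : Type
  | x (p : Fin n)
  | tau (a : Fin (n - 1))
  | e (ν : Fin n → I)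

variable (n : ℕ)

abbrev RFree := FreeAlgebra k (RGen I n)

def xF (p : Fin n) : RFree k I n := FreeAlgebra.ι k (RGen.x p)
def tauF (a : Fin (n - 1)) : RFree k I n := FreeAlgebra.ι k (RGen.tau a)
def eF (ν : Fin n → I) : RFree k I n := FreeAlgebra.ι k (RGen.e ν)

/-- Evaluation `Q(w,z) ↦ Q(x_a, x_{a+1})` into the free algebra on the generators of
`R_n(Q)`. -/
noncomputable def evalX (a : Fin (n - 1)) : FreeAlgebra k (Fin 2) →ₐ[k] RFree k I n :=
  FreeAlgebra.lift k fun t : Fin 2 => if t = 0 then xF k I n (lo a) else xF k I n (hi a)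

/-- Evaluation of a three-variable element at `(x_a, x_{a+1}, x_{a+2})`. -/
noncomputable def evalX3 (a b : Fin (n - 1)) : FreeAlgebra k (Fin 3) →ₐ[k] RFree k I n :=
  FreeAlgebra.lift k fun t : Fin 3 =>
    if t = 0 then xF k I n (lo a) else if t = 1 then xF k I n (hi a) else xF k I n (hi b)

/-- The defining relations of the quiver Hecke superalgebra `R_n(Q)`
(Definition 3.2 of Kang–Kashiwara–Tsuchioka), for a family of representatives
`Qrep i j ∈ k⟨w,z⟩` of the `Q_{i,j} ∈ A^{i,j}`. -/
inductive RRel (Qrep : I → I → FreeAlgebra k (Fin 2)) :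
    RFree k I n → RFree k I n → Prop
  /- (i) orthogonal idempotents summing to `1` -/
  | e_orth (μ ν : Fin n → I) (h : μ ≠ ν) : RRel Qrep (eF k I n μ * eF k I n ν) 0
  | e_idem (ν : Fin n → I) : RRel Qrep (eF k I n ν * eF k I n ν) (eF k I n ν)
  | e_sum : RRel Qrep (∑ ν : Fin n → I, eF k I n ν) 1
  | xe (p : Fin n) (ν : Fin n → I) :
      RRel Qrep (xF k I n p * eF k I n ν) (eF k I n ν * xF k I n p)
  | taue (a : Fin (n - 1)) (ν : Fin n → I) :
      RRel Qrep (tauF k I n a * eF k I n ν)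
        (eF k I n (fun p => ν (sperm a p)) * tauF k I n a)
  /- (ii) skew-commutation of the `x`'s -/
  | xx (p q : Fin n) (ν : Fin n → I) :
      RRel Qrep (xF k I n p * xF k I n q * eF k I n ν)
        (if p ≠ q ∧ podd (ν p) ∧ podd (ν q) then
          -(xF k I n q * xF k I n p * eF k I n ν)
        else xF k I n q * xF k I n p * eF k I n ν)
  /- (iii) `τ_a x_p e(ν) = (−1)^{p(ν_p)p(ν_a)p(ν_{a+1})} x_p τ_a e(ν)` for `p ≠ a, a+1` -/
  | taux (a : Fin (n - 1)) (p : Fin n) (ν : Fin n → I) (h1 : p ≠ lo a) (h2 : p ≠ hi a) :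
      RRel Qrep (tauF k I n a * xF k I n p * eF k I n ν)
        (if podd (ν p) ∧ podd (ν (lo a)) ∧ podd (ν (hi a)) then
          -(xF k I n p * tauF k I n a * eF k I n ν)
        else xF k I n p * tauF k I n a * eF k I n ν)
  /- (iv) `(τ_a x_{a+1} − (−1)^{p(ν_a)p(ν_{a+1})} x_a τ_a) e(ν) = δ_{ν_a,ν_{a+1}} e(ν)` … -/
  | taux1 (a : Fin (n - 1)) (ν : Fin n → I) :
      RRel Qrep
        (tauF k I n a * xF k I n (hi a) * eF k I n ν
          - (if podd (ν (lo a)) ∧ podd (ν (hi a)) then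
              -(xF k I n (lo a) * tauF k I n a * eF k I n ν)
            else xF k I n (lo a) * tauF k I n a * eF k I n ν))
        (if ν (lo a) = ν (hi a) then eF k I n ν else 0)
  /- … `= (x_{a+1} τ_a − (−1)^{p(ν_a)p(ν_{a+1})} τ_a x_a) e(ν)` -/
  | taux2 (a : Fin (n - 1)) (ν : Fin n → I) :
      RRel Qrep
        (xF k I n (hi a) * tauF k I n a * eF k I n ν
          - (if podd (ν (lo a)) ∧ podd (ν (hi a)) then
              -(tauF k I n a * xF k I n (lo a) * eF k I n ν)
            else tauF k I n a * xF k I n (lo a) * eF k I n ν))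
        (if ν (lo a) = ν (hi a) then eF k I n ν else 0)
  /- (v) `τ_a² e(ν) = Q_{ν_a,ν_{a+1}}(x_a, x_{a+1}) e(ν)` -/
  | tausq (a : Fin (n - 1)) (ν : Fin n → I) :
      RRel Qrep (tauF k I n a * tauF k I n a * eF k I n ν)
        (evalX k I n a (Qrep (ν (lo a)) (ν (hi a))) * eF k I n ν)
  /- (vi) `τ_a τ_b e(ν) = (−1)^{…} τ_b τ_a e(ν)` for `|a − b| > 1` -/
  | tautau (a b : Fin (n - 1)) (ν : Fin n → I)
      (h : (a : ℕ) + 1 < (b : ℕ) ∨ (b : ℕ) + 1 < (a : ℕ)) :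
      RRel Qrep (tauF k I n a * tauF k I n b * eF k I n ν)
        (if podd (ν (lo a)) ∧ podd (ν (hi a)) ∧ podd (ν (lo b)) ∧ podd (ν (hi b)) then
          -(tauF k I n b * tauF k I n a * eF k I n ν)
        else tauF k I n b * tauF k I n a * eF k I n ν)
  /- (vii) the braid-deformation relation, even case: `D` is the divided difference
     `(Q(x_{a+2},x_{a+1}) − Q(x_a,x_{a+1}))/(x_{a+2} − x_a)` -/
  | braid_even (a b : Fin (n - 1)) (hab : (b : ℕ) = (a : ℕ) + 1) (ν : Fin n → I)
      (hsame : ν (lo a) = ν (hi b)) (hev : podd (ν (lo a)) = false)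
      (D : FreeAlgebra k (Fin 3))
      (hD : mkA3 k I podd (ν (lo a)) (ν (hi a))
              (D * (FreeAlgebra.ι k (2 : Fin 3) - FreeAlgebra.ι k (0 : Fin 3))) =
            mkA3 k I podd (ν (lo a)) (ν (hi a))
              (sub21 k (Qrep (ν (lo a)) (ν (hi a))) - sub01 k (Qrep (ν (lo a)) (ν (hi a))))) :
      RRel Qrep
        (tauF k I n b * tauF k I n a * tauF k I n b * eF k I n ν
          - tauF k I n a * tauF k I n b * tauF k I n a * eF k I n ν)
        (evalX3 k I n a b D * eF k I n ν)
  /- (vii) odd case: `D = (Q(x_{a+2},x_{a+1}) − Q(x_a,x_{a+1}))/(x_{a+2}² − x_a²)` -/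
  | braid_odd (a b : Fin (n - 1)) (hab : (b : ℕ) = (a : ℕ) + 1) (ν : Fin n → I)
      (hsame : ν (lo a) = ν (hi b)) (hodd : podd (ν (lo a)) = true)
      (D : FreeAlgebra k (Fin 3))
      (hD : mkA3 k I podd (ν (lo a)) (ν (hi a))
              (D * (FreeAlgebra.ι k (2 : Fin 3) * FreeAlgebra.ι k (2 : Fin 3)
                     - FreeAlgebra.ι k (0 : Fin 3) * FreeAlgebra.ι k (0 : Fin 3))) =
            mkA3 k I podd (ν (lo a)) (ν (hi a))
              (sub21 k (Qrep (ν (lo a)) (ν (hi a))) - sub01 k (Qrep (ν (lo a)) (ν (hi a))))) :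
      RRel Qrep
        (tauF k I n b * tauF k I n a * tauF k I n b * eF k I n ν
          - tauF k I n a * tauF k I n b * tauF k I n a * eF k I n ν)
        (if podd (ν (hi a)) then
          -((xF k I n (hi b) - xF k I n (lo a)) * evalX3 k I n a b D * eF k I n ν)
        else (xF k I n (hi b) - xF k I n (lo a)) * evalX3 k I n a b D * eF k I n ν)
  /- (vii) the remaining case -/
  | braid_zero (a b : Fin (n - 1)) (hab : (b : ℕ) = (a : ℕ) + 1) (ν : Fin n → I)
      (hdiff : ν (lo a) ≠ ν (hi b)) :
      RRel Qrep
        (tauF k I n b * tauF k I n a * tauF k I n b * eF k I n ν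
          - tauF k I n a * tauF k I n b * tauF k I n a * eF k I n ν) 0

/-- The quiver Hecke superalgebra `R_n(Q)`. -/
abbrev R (Qrep : I → I → FreeAlgebra k (Fin 2)) := RingQuot (RRel k I podd n Qrep)

noncomputable def xR (Qrep : I → I → FreeAlgebra k (Fin 2)) (p : Fin n) :
    R k I podd n Qrep :=
  RingQuot.mkAlgHom k (RRel k I podd n Qrep) (xF k I n p)
noncomputable def tauR (Qrep : I → I → FreeAlgebra k (Fin 2)) (a : Fin (n - 1)) :
    R k I podd n Qrep :=
  RingQuot.mkAlgHom k (RRel k I podd n Qrep) (tauF k I n a)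
noncomputable def eR (Qrep : I → I → FreeAlgebra k (Fin 2)) (ν : Fin n → I) :
    R k I podd n Qrep :=
  RingQuot.mkAlgHom k (RRel k I podd n Qrep) (eF k I n ν)

/-- `l` is a reduced expression of `w ∈ S_n`. -/
def IsReducedWord (l : List (Fin (n - 1))) (w : Equiv.Perm (Fin n)) : Prop :=
  (l.map sperm).prod = w ∧
    ∀ l' : List (Fin (n - 1)), (l'.map sperm).prod = w → l.length ≤ l'.length

/-- `x^a = x_1^{a_1} ⋯ x_n^{a_n}`. -/
noncomputable def xPow (Qrep : I → I → FreeAlgebra k (Fin 2)) (a : Fin n → ℕ) :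
    R k I podd n Qrep :=
  ((List.finRange n).map fun p => xR k I podd n Qrep p ^ a p).prod

/-- `τ_w = τ_{i_1} ⋯ τ_{i_ℓ}`. -/
noncomputable def tauProd (Qrep : I → I → FreeAlgebra k (Fin 2)) (l : List (Fin (n - 1))) :
    R k I podd n Qrep :=
  (l.map (tauR k I podd n Qrep)).prod

/-- The PBW family `x^a τ_w e(ν)` of `R_n(Q)`. -/
noncomputable def pbwFamily (Qrep : I → I → FreeAlgebra k (Fin 2))
    (red : Equiv.Perm (Fin n) → List (Fin (n - 1)))
    (t : (Fin n → ℕ) × Equiv.Perm (Fin n) × (Fin n → I)) : R k I podd n Qrep :=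
  xPow k I podd n Qrep t.1 * tauProd k I podd n Qrep (red t.2.1) * eR k I podd n Qrep t.2.2

set_option linter.unusedSectionVars false

section Permutations

variable {n}

lemma lo_lt_hi (a : Fin (n - 1)) : lo a < hi a := by
  simp [lo, hi, Fin.lt_def]

lemma lo_ne_hi (a : Fin (n - 1)) : lo a ≠ hi a := (lo_lt_hi a).ne

@[simp] lemma sperm_lo (a : Fin (n - 1)) : sperm a (lo a) = hi a := Equiv.swap_apply_left _ _

@[simp] lemma sperm_hi (a : Fin (n - 1)) : sperm a (hi a) = lo a := Equiv.swap_apply_right _ _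

lemma sperm_of_ne {a : Fin (n - 1)} {p : Fin n} (h1 : p ≠ lo a) (h2 : p ≠ hi a) :
    sperm a p = p := Equiv.swap_apply_of_ne_of_ne h1 h2

@[simp] lemma sperm_mul_self (a : Fin (n - 1)) : sperm a * sperm a = 1 := Equiv.swap_mul_self _ _

@[simp] lemma sperm_inv (a : Fin (n - 1)) : (sperm a)⁻¹ = sperm a := Equiv.swap_inv _ _

@[simp] lemma sperm_sperm (a : Fin (n - 1)) (p : Fin n) : sperm a (sperm a p) = p :=
  Equiv.swap_apply_self _ _ _

@[simp] lemma mul_sperm_mul_sperm (g : Equiv.Perm (Fin n)) (a : Fin (n - 1)) :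
    g * sperm a * sperm a = g := by rw [mul_assoc, sperm_mul_self, mul_one]

/-- The number of inversions of a permutation. -/
def inversions (g : Equiv.Perm (Fin n)) : ℕ :=
  (Finset.univ.filter fun t : Fin n × Fin n => t.1 < t.2 ∧ g t.2 < g t.1).card

lemma sperm_lt_sperm {a : Fin (n - 1)} {i j : Fin n} (hij : i < j)
    (h : ¬ (i = lo a ∧ j = hi a)) : sperm a i < sperm a j := by
  simp only [sperm, Equiv.swap_apply_def, lo, hi, Fin.ext_iff, Fin.lt_def] at *
  split_ifs <;> simp_all <;> omega

lemma inversions_mul_sperm_of_lt {g : Equiv.Perm (Fin n)} {a : Fin (n - 1)}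
    (h : g (lo a) < g (hi a)) : inversions (g * sperm a) = inversions g + 1 := by
  classical
  have key : (Finset.univ.filter fun t : Fin n × Fin n =>
      t.1 < t.2 ∧ (g * sperm a) t.2 < (g * sperm a) t.1) =
      insert (lo a, hi a) ((Finset.univ.filter fun t : Fin n × Fin n =>
        t.1 < t.2 ∧ g t.2 < g t.1).map
          ((sperm a).prodCongr (sperm a)).toEmbedding) := by
    ext ⟨i, j⟩
    simp only [Finset.mem_filter, Finset.mem_univ, true_and, Finset.mem_insert, Finset.mem_map,
      Prod.mk.injEq, Prod.exists]
    rw [Equiv.Perm.mul_apply, Equiv.Perm.mul_apply]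
    constructor
    · rintro ⟨hij, hg⟩
      by_cases he : i = lo a ∧ j = hi a
      · exact Or.inl he
      · exact Or.inr ⟨sperm a i, sperm a j, ⟨sperm_lt_sperm hij he, hg⟩, by simp⟩
    · rintro (⟨rfl, rfl⟩ | ⟨i', j', ⟨hij, hg⟩, he⟩)
      · exact ⟨lo_lt_hi a, by simpa using h⟩
      · simp only [Equiv.coe_toEmbedding, Equiv.prodCongr_apply, Prod.map_apply,
          Prod.mk.injEq] at he
        obtain ⟨rfl, rfl⟩ := he
        refine ⟨sperm_lt_sperm hij ?_, by simpa using hg⟩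
        rintro ⟨rfl, rfl⟩
        exact absurd hg h.not_gt
  rw [inversions, key, Finset.card_insert_of_notMem, Finset.card_map, inversions]
  simp only [Finset.mem_map, Finset.mem_filter, Finset.mem_univ, true_and, Prod.exists,
    Equiv.coe_toEmbedding, Equiv.prodCongr_apply, Prod.map_apply, Prod.mk.injEq, not_exists,
    not_and]
  rintro i j ⟨hij, -⟩ hi' hj'
  have e1 : i = hi a := by rw [← sperm_sperm a i, hi', sperm_lo]
  have e2 : j = lo a := by rw [← sperm_sperm a j, hj', sperm_hi]
  subst e1 e2
  exact absurd hij (lo_lt_hi a).not_gt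

lemma inversions_mul_sperm_of_gt {g : Equiv.Perm (Fin n)} {a : Fin (n - 1)}
    (h : g (hi a) < g (lo a)) : inversions (g * sperm a) + 1 = inversions g := by
  have := inversions_mul_sperm_of_lt (g := g * sperm a) (a := a) (by simpa using h)
  rw [← this, mul_sperm_mul_sperm]

lemma eq_one_of_forall_lt {g : Equiv.Perm (Fin n)}
    (h : ∀ a : Fin (n - 1), g (lo a) < g (hi a)) : g = 1 := by
  have hm : StrictMono g := by
    cases n with
    | zero => intro i; exact i.elim0
    | succ m => exact Fin.strictMono_iff_lt_succ.2 fun i => h i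
  have : hm.orderIsoOfSurjective _ g.surjective = OrderIso.refl _ := Subsingleton.elim _ _
  ext i
  have := congrArg (fun e : Fin n ≃o Fin n => (e i : ℕ)) this
  simpa using this

/-- The permutation `s_{i_1} ⋯ s_{i_ℓ}` of a word. -/
def wordPerm (l : List (Fin (n - 1))) : Equiv.Perm (Fin n) := (l.map sperm).prod

@[simp] lemma wordPerm_cons (a : Fin (n - 1)) (l : List (Fin (n - 1))) :
    wordPerm (a :: l) = sperm a * wordPerm l := by simp [wordPerm]

@[simp] lemma wordPerm_nil : wordPerm ([] : List (Fin (n - 1))) = 1 := rfl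

@[simp] lemma inversions_one : inversions (1 : Equiv.Perm (Fin n)) = 0 := by
  simp only [inversions, Finset.card_eq_zero, Finset.filter_eq_empty_iff]
  rintro ⟨i, j⟩ - ⟨h, h'⟩
  exact absurd h' h.not_gt

lemma lo_lt_or_gt (g : Equiv.Perm (Fin n)) (a : Fin (n - 1)) :
    g (lo a) < g (hi a) ∨ g (hi a) < g (lo a) :=
  lt_or_gt_of_ne fun h => lo_ne_hi a (g.injective h)

lemma inversions_wordPerm_le (l : List (Fin (n - 1))) :
    inversions (wordPerm l)⁻¹ ≤ l.length := by
  induction l with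
  | nil => simp
  | cons a l ih =>
    rw [wordPerm_cons, mul_inv_rev, sperm_inv, List.length_cons]
    rcases lo_lt_or_gt (wordPerm l)⁻¹ a with h | h
    · rw [inversions_mul_sperm_of_lt h]; omega
    · have := inversions_mul_sperm_of_gt h; omega

/-- A word is reduced if its length is the number of inversions of its permutation. -/
def Reduced (l : List (Fin (n - 1))) : Prop := inversions (wordPerm l)⁻¹ = l.length

lemma exists_reduced_wordPerm (w : Equiv.Perm (Fin n)) :
    ∃ l, wordPerm l = w ∧ Reduced l := by
  induction hm : inversions w⁻¹ generalizing w with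
  | zero =>
    refine ⟨[], ?_, by simp [Reduced]⟩
    have : w⁻¹ = 1 := eq_one_of_forall_lt fun a => by
      rcases lo_lt_or_gt w⁻¹ a with h | h
      · exact h
      · have := inversions_mul_sperm_of_gt h; omega
    rw [wordPerm_nil, ← inv_inv w, this, inv_one]
  | succ m ih =>
    obtain ⟨a, ha⟩ : ∃ a : Fin (n - 1), w⁻¹ (hi a) < w⁻¹ (lo a) := by
      by_contra hc
      push Not at hc
      have : w⁻¹ = 1 := eq_one_of_forall_lt fun a =>
        (lo_lt_or_gt w⁻¹ a).resolve_right (hc a).not_gt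
      rw [this, inversions_one] at hm
      omega
    have h1 := inversions_mul_sperm_of_gt ha
    obtain ⟨l, hl, hr⟩ := ih (sperm a * w) (by rw [mul_inv_rev, sperm_inv]; omega)
    have hw : wordPerm (a :: l) = w := by rw [wordPerm_cons, hl, ← mul_assoc]; simp
    refine ⟨a :: l, hw, ?_⟩
    rw [Reduced, hl, mul_inv_rev, sperm_inv] at hr
    rw [Reduced, hw, List.length_cons]
    omega

lemma IsReducedWord.reduced {l : List (Fin (n - 1))} {w : Equiv.Perm (Fin n)}
    (h : IsReducedWord n l w) : wordPerm l = w ∧ Reduced l := by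
  refine ⟨h.1, (inversions_wordPerm_le l).antisymm ?_⟩
  obtain ⟨l', hl', hr'⟩ := exists_reduced_wordPerm w
  have hw : wordPerm l = w := h.1
  rw [hw, ← hl', hr']
  exact h.2 l' hl'

lemma Reduced.tail {a : Fin (n - 1)} {l : List (Fin (n - 1))} (h : Reduced (a :: l)) :
    Reduced l := by
  have h0 := inversions_wordPerm_le l
  rw [Reduced, wordPerm_cons, mul_inv_rev, sperm_inv, List.length_cons] at h
  rw [Reduced]
  rcases lo_lt_or_gt (wordPerm l)⁻¹ a with h' | h'
  · have := inversions_mul_sperm_of_lt h'; omega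
  · have := inversions_mul_sperm_of_gt h'; omega

lemma Reduced.lt {a : Fin (n - 1)} {l : List (Fin (n - 1))} (h : Reduced (a :: l)) :
    (wordPerm l)⁻¹ (lo a) < (wordPerm l)⁻¹ (hi a) := by
  have h0 := inversions_wordPerm_le l
  rw [Reduced, wordPerm_cons, mul_inv_rev, sperm_inv, List.length_cons] at h
  rcases lo_lt_or_gt (wordPerm l)⁻¹ a with h' | h'
  · exact h'
  · have := inversions_mul_sperm_of_gt h'; omega

lemma Reduced.descent {a : Fin (n - 1)} {l : List (Fin (n - 1))} (h : Reduced (a :: l)) :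
    (wordPerm (a :: l))⁻¹ (hi a) < (wordPerm (a :: l))⁻¹ (lo a) := by
  simpa [mul_inv_rev] using h.lt

lemma reduced_cons_iff {a : Fin (n - 1)} {l : List (Fin (n - 1))} :
    Reduced (a :: l) ↔ Reduced l ∧ (wordPerm l)⁻¹ (lo a) < (wordPerm l)⁻¹ (hi a) := by
  refine ⟨fun h => ⟨h.tail, h.lt⟩, fun ⟨h, h'⟩ => ?_⟩
  rw [Reduced, wordPerm_cons, mul_inv_rev, sperm_inv, inversions_mul_sperm_of_lt h', h,
    List.length_cons]

/-- A descent of `w⁻¹` at `a` lets one strip `s_a` off `w` on the left. -/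
lemma exists_reduced_cons {w : Equiv.Perm (Fin n)} {a : Fin (n - 1)}
    (h : w⁻¹ (hi a) < w⁻¹ (lo a)) : ∃ l, wordPerm (a :: l) = w ∧ Reduced (a :: l) := by
  obtain ⟨l, hl, hr⟩ := exists_reduced_wordPerm (sperm a * w)
  refine ⟨l, by rw [wordPerm_cons, hl, ← mul_assoc]; simp, reduced_cons_iff.2 ⟨hr, ?_⟩⟩
  simpa [hl, mul_inv_rev] using h

end Permutations

section SkewPolynomials

open FreeAlgebra

variable {k I podd}

lemma mkA3_surjective (i j : I) : Function.Surjective (mkA3 k I podd i j) :=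
  RingQuot.mkAlgHom_surjective k _

/-- Homomorphisms out of `k⟨w,z⟩` that respect the skew commutation of `w` and `z` factor
through `A^{i,j}`. -/
lemma eq_of_mkA2_eq {B : Type*} [Ring B] [Algebra k B] {i j : I}
    (f : FreeAlgebra k (Fin 2) →ₐ[k] B)
    (hf : f (ι k 1) * f (ι k 0) =
      if podd i ∧ podd j then -(f (ι k 0) * f (ι k 1)) else f (ι k 0) * f (ι k 1))
    {q r : FreeAlgebra k (Fin 2)} (h : mkA2 k I podd i j q = mkA2 k I podd i j r) :
    f q = f r := by
  have hf' : ∀ ⦃x y⦄, ARel2 k I podd i j x y → f x = f y := by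
    rintro _ _ ⟨⟩
    rw [map_mul, hf]
    split_ifs <;> simp
  have key : ∀ q, RingQuot.liftAlgHom k ⟨f, hf'⟩ (mkA2 k I podd i j q) = f q := fun q =>
    RingQuot.liftAlgHom_mkAlgHom_apply k f hf' q
  rw [← key q, ← key r, h]

/-- Homomorphisms out of `k⟨x₀,x₁,x₂⟩` that respect the skew commutation of the variables
factor through the three-variable skew polynomial algebra. -/
lemma eq_of_mkA3_eq {B : Type*} [Ring B] [Algebra k B] {i j : I}
    (f : FreeAlgebra k (Fin 3) →ₐ[k] B)
    (hf : ∀ s t : Fin 3, (s : ℕ) < t → f (ι k t) * f (ι k s) =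
      if podd (if s = 1 then j else i) ∧ podd (if t = 1 then j else i) then
        -(f (ι k s) * f (ι k t)) else f (ι k s) * f (ι k t))
    {q r : FreeAlgebra k (Fin 3)} (h : mkA3 k I podd i j q = mkA3 k I podd i j r) :
    f q = f r := by
  have hf' : ∀ ⦃x y⦄, ARel3 k I podd i j x y → f x = f y := by
    rintro _ _ ⟨s, t, hst⟩
    rw [map_mul, hf s t hst]
    split_ifs <;> simp
  have key : ∀ q, RingQuot.liftAlgHom k ⟨f, hf'⟩ (mkA3 k I podd i j q) = f q := fun q =>
    RingQuot.liftAlgHom_mkAlgHom_apply k f hf' q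
  rw [← key q, ← key r, h]

lemma mkA2_one_mul_zero (i j : I) :
    mkA2 k I podd i j (ι k 1) * mkA2 k I podd i j (ι k 0) =
      if podd i ∧ podd j then -(mkA2 k I podd i j (ι k 0) * mkA2 k I podd i j (ι k 1))
      else mkA2 k I podd i j (ι k 0) * mkA2 k I podd i j (ι k 1) := by
  have := RingQuot.mkAlgHom_rel k (ARel2.comm (k := k) (I := I) (podd := podd) (i := i) (j := j))
  rw [map_mul] at this
  rw [mkA2, this]
  split_ifs <;> simp

lemma mkA3_mul (i j : I) {s t : Fin 3} (h : (s : ℕ) < t) :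
    mkA3 k I podd i j (ι k t) * mkA3 k I podd i j (ι k s) =
      if podd (if s = 1 then j else i) ∧ podd (if t = 1 then j else i) then
        -(mkA3 k I podd i j (ι k s) * mkA3 k I podd i j (ι k t))
      else mkA3 k I podd i j (ι k s) * mkA3 k I podd i j (ι k t) := by
  have := RingQuot.mkAlgHom_rel k
    (ARel3.comm (k := k) (I := I) (podd := podd) (i := i) (j := j) s t h)
  rw [map_mul] at this
  rw [mkA3, this]
  split_ifs <;> simp

lemma mul_eq_neg_mul_of_mul_eq_neg {B : Type*} [Ring B] {w z : B} (h : z * w = -(w * z)) :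
    w * z = -z * w := by
  rw [neg_mul, h, neg_neg]

lemma neg_mul_neg_skew {B : Type*} [Ring B] {w z : B} {P : Prop} [Decidable P]
    (h : z * w = if P then -(w * z) else w * z) :
    z * -w = if P then -(-w * z) else -w * z := by
  rw [mul_neg, h]
  split_ifs <;> simp

lemma add_self_eq_of_eq_add_mul {B : Type*} [Ring B] {q u v w : B} (h : q = u + v * w)
    (h' : q = u + v * -w) : q + q = u + u := by
  nth_rw 1 [h, h']
  rw [mul_neg]
  abel

lemma mul_self_commute_of_mul_eq_neg {B : Type*} [Ring B] {w z : B} (h : w * z = -(z * w)) :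
    Commute (w * w) z := by
  rw [Commute, SemiconjBy, mul_assoc, h, mul_neg, ← mul_assoc, h, neg_mul, neg_neg, mul_assoc]

/-- An element of a quotient of a free algebra is central if it commutes with the generators. -/
lemma commute_of_commute_gen {B X : Type*} [Ring B] [Algebra k B]
    {f : FreeAlgebra k X →ₐ[k] B} (hf : Function.Surjective f) {c : B}
    (hc : ∀ t, Commute c (f (ι k t))) (y : B) : Commute c y := by
  obtain ⟨q, rfl⟩ := hf y
  induction q using FreeAlgebra.induction with
  | grade0 r => rw [AlgHom.commutes]; exact Algebra.commute_algebraMap_right r c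
  | grade1 t => exact hc t
  | mul a b ha hb => rw [map_mul]; exact ha.mul_right hb
  | add a b ha hb => rw [map_add]; exact ha.add_right hb

/-- If two homomorphisms agree on generators modulo multiples of a central element, they agree
everywhere modulo multiples of that element. -/
lemma exists_sub_eq_mul {B X : Type*} [Ring B] [Algebra k B]
    (f g : FreeAlgebra k X →ₐ[k] B) {c : B} (hc : ∀ y, Commute c y)
    (h : ∀ t, ∃ D, f (ι k t) - g (ι k t) = D * c) (q : FreeAlgebra k X) :
    ∃ D, f q - g q = D * c := by
  induction q using FreeAlgebra.induction with
  | grade0 r => exact ⟨0, by simp⟩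
  | grade1 t => exact h t
  | mul a b ha hb =>
    obtain ⟨D, hD⟩ := ha
    obtain ⟨E, hE⟩ := hb
    refine ⟨D * f b + g a * E, ?_⟩
    have : f (a * b) - g (a * b) = (f a - g a) * f b + g a * (f b - g b) := by
      simp only [map_mul]; noncomm_ring
    rw [this, hD, hE, add_mul, mul_assoc, (hc _).eq]
    simp only [mul_assoc]
  | add a b ha hb =>
    obtain ⟨D, hD⟩ := ha
    obtain ⟨E, hE⟩ := hb
    refine ⟨D + E, ?_⟩
    rw [add_mul, ← hD, ← hE, map_add, map_add]; abel

/-- The substitution `(w,z) ↦ (w²,z)`. -/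
noncomputable def sqW (k : Type) [CommRing k] :
    FreeAlgebra k (Fin 2) →ₐ[k] FreeAlgebra k (Fin 2) :=
  FreeAlgebra.lift k fun t : Fin 2 => if t = 0 then ι k 0 * ι k 0 else ι k 1

@[simp] lemma sqW_zero : sqW k (ι k 0) = ι k 0 * ι k 0 := by simp [sqW]
@[simp] lemma sqW_one : sqW k (ι k 1) = ι k 1 := by simp [sqW]
@[simp] lemma negW_zero : negW k (ι k 0) = -ι k 0 := by simp [negW]
@[simp] lemma negW_one : negW k (ι k 1) = ι k 1 := by simp [negW]
@[simp] lemma swapWZ_zero : swapWZ k (ι k 0) = ι k 1 := by simp [swapWZ]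
@[simp] lemma swapWZ_one : swapWZ k (ι k 1) = ι k 0 := by simp [swapWZ]
@[simp] lemma sub21_zero : sub21 k (ι k 0) = ι k 2 := by simp [sub21]
@[simp] lemma sub21_one : sub21 k (ι k 1) = ι k 1 := by simp [sub21]
@[simp] lemma sub01_zero : sub01 k (ι k 0) = ι k 0 := by simp [sub01]
@[simp] lemma sub01_one : sub01 k (ι k 1) = ι k 1 := by simp [sub01]

lemma negW_sqW (q : FreeAlgebra k (Fin 2)) : negW k (sqW k q) = sqW k q := by
  suffices (negW k).comp (sqW k) = sqW k from DFunLike.congr_fun this q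
  ext t
  fin_cases t <;> simp

lemma exists_mkA2_zero_mul_sqW (i j : I) (q : FreeAlgebra k (Fin 2)) :
    ∃ r, mkA2 k I podd i j (ι k 0) * mkA2 k I podd i j (sqW k q) =
      mkA2 k I podd i j (sqW k r) * mkA2 k I podd i j (ι k 0) := by
  induction q using FreeAlgebra.induction with
  | grade0 r =>
    refine ⟨algebraMap _ _ r, ?_⟩
    simp only [AlgHom.commutes]
    exact (Algebra.commutes _ _).symm
  | grade1 t =>
    fin_cases t
    · exact ⟨ι k 0, by simp [mul_assoc]⟩
    · by_cases h : podd i ∧ podd j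
      · refine ⟨-ι k 1, ?_⟩
        have := mkA2_one_mul_zero (k := k) (podd := podd) i j
        rw [if_pos h] at this
        simp only [Fin.mk_one, sqW_one, map_neg]
        exact mul_eq_neg_mul_of_mul_eq_neg this
      · refine ⟨ι k 1, ?_⟩
        have := mkA2_one_mul_zero (k := k) (podd := podd) i j
        rw [if_neg h] at this
        simpa using this.symm
  | mul a b ha hb =>
    obtain ⟨r, hr⟩ := ha
    obtain ⟨s, hs⟩ := hb
    refine ⟨r * s, ?_⟩
    rw [map_mul, map_mul, ← mul_assoc, hr, mul_assoc, hs, map_mul, map_mul, mul_assoc]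
  | add a b ha hb =>
    obtain ⟨r, hr⟩ := ha
    obtain ⟨s, hs⟩ := hb
    exact ⟨r + s, by rw [map_add, map_add, mul_add, hr, hs, map_add, map_add, add_mul]⟩

/-- Every element of `A^{i,j}` has the form `u(w²,z) + v(w²,z)w`. -/
lemma exists_mkA2_eq (i j : I) (q : FreeAlgebra k (Fin 2)) :
    ∃ u v, mkA2 k I podd i j q = mkA2 k I podd i j (sqW k u + sqW k v * ι k 0) := by
  induction q using FreeAlgebra.induction with
  | grade0 r => exact ⟨algebraMap _ _ r, 0, by simp⟩
  | grade1 t =>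
    fin_cases t
    · exact ⟨0, 1, by simp⟩
    · exact ⟨ι k 1, 0, by simp⟩
  | mul a b ha hb =>
    obtain ⟨u, v, h⟩ := ha
    obtain ⟨u', v', h'⟩ := hb
    obtain ⟨r, hr⟩ := exists_mkA2_zero_mul_sqW (k := k) (podd := podd) i j u'
    obtain ⟨s, hs⟩ := exists_mkA2_zero_mul_sqW (k := k) (podd := podd) i j v'
    refine ⟨u * u' + v * s * ι k 0, u * v' + v * r, ?_⟩
    rw [map_mul, h, h']
    simp only [map_add, map_mul, sqW_zero, add_mul, mul_add, mul_assoc] at *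
    rw [hr, ← mul_assoc (mkA2 k I podd i j (ι k 0)) (mkA2 k I podd i j (sqW k v')), hs]
    simp only [mul_assoc]
    abel
  | add a b ha hb =>
    obtain ⟨u, v, h⟩ := ha
    obtain ⟨u', v', h'⟩ := hb
    exact ⟨u + u', v + v', by simp only [map_add, add_mul, h, h']; abel⟩

/-- An element of `A^{i,j}` invariant under `w ↦ −w` is a polynomial in `w²` and `z`. -/
lemma exists_mkA2_eq_sqW [Invertible (2 : k)] {i j : I} {q : FreeAlgebra k (Fin 2)}
    (hq : mkA2 k I podd i j (negW k q) = mkA2 k I podd i j q) :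
    ∃ u, mkA2 k I podd i j q = mkA2 k I podd i j (sqW k u) := by
  obtain ⟨u, v, h⟩ := exists_mkA2_eq (k := k) (podd := podd) i j q
  have h' := eq_of_mkA2_eq ((mkA2 k I podd i j).comp (negW k)) (by
    simp only [AlgHom.comp_apply, negW_zero, negW_one, map_neg]
    exact neg_mul_neg_skew (mkA2_one_mul_zero i j)) h
  simp only [AlgHom.comp_apply, map_add, map_mul, negW_sqW, negW_zero, map_neg] at h' h
  refine ⟨u, ?_⟩
  rw [hq] at h'
  have h2 : (2 : k) • mkA2 k I podd i j q = (2 : k) • mkA2 k I podd i j (sqW k u) := by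
    rw [two_smul, two_smul]
    exact add_self_eq_of_eq_add_mul h h'
  simpa using congrArg (fun y => (⅟ (2 : k)) • y) h2

lemma mkA3_commute_or (i j : I) (s t : Fin 3) :
    mkA3 k I podd i j (ι k s) * mkA3 k I podd i j (ι k t) =
        mkA3 k I podd i j (ι k t) * mkA3 k I podd i j (ι k s) ∨
      mkA3 k I podd i j (ι k s) * mkA3 k I podd i j (ι k t) =
        -(mkA3 k I podd i j (ι k t) * mkA3 k I podd i j (ι k s)) := by
  rcases lt_trichotomy (s : ℕ) t with h | h | h
  · rw [mkA3_mul i j h]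
    split_ifs <;> simp
  · rw [Fin.ext h]; simp
  · rw [mkA3_mul i j h]
    split_ifs <;> simp

lemma mkA3_commute_of_even {i : I} (hi : podd i = false) (j : I) (s t : Fin 3) (ht : t ≠ 1) :
    Commute (mkA3 k I podd i j (ι k t)) (mkA3 k I podd i j (ι k s)) := by
  rw [Commute, SemiconjBy]
  rcases lt_trichotomy (s : ℕ) t with h | h | h
  · rw [mkA3_mul i j h, if_neg]; simp [ht, hi]
  · rw [Fin.ext h]
  · rw [mkA3_mul i j h, if_neg]; simp [ht, hi]

lemma mkA3_sq_commute (i j : I) (s t : Fin 3) :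
    Commute (mkA3 k I podd i j (ι k t * ι k t)) (mkA3 k I podd i j (ι k s)) := by
  rw [Commute, SemiconjBy, map_mul]
  rcases mkA3_commute_or (k := k) (podd := podd) i j t s with h | h
  · rw [mul_assoc, h, ← mul_assoc, h, mul_assoc]
  · exact mul_self_commute_of_mul_eq_neg h

/-- The divided difference of an element of `A^{i,j}`, `i` even. -/
lemma exists_divided_difference_of_even {i : I} (hi : podd i = false) (j : I)
    (q : FreeAlgebra k (Fin 2)) :
    ∃ D, mkA3 k I podd i j (D * (ι k 2 - ι k 0)) =
      mkA3 k I podd i j (sub21 k q - sub01 k q) := by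
  obtain ⟨D, hD⟩ := exists_sub_eq_mul ((mkA3 k I podd i j).comp (sub21 k))
    ((mkA3 k I podd i j).comp (sub01 k)) (c := mkA3 k I podd i j (ι k 2 - ι k 0))
    (commute_of_commute_gen (mkA3_surjective i j) fun t => by
      rw [map_sub]
      exact (mkA3_commute_of_even hi j t 2 (by decide)).sub_left
        (mkA3_commute_of_even hi j t 0 (by decide)))
    (fun t => by
      fin_cases t
      · exact ⟨1, by simp⟩
      · exact ⟨0, by simp⟩) q
  obtain ⟨D, rfl⟩ := mkA3_surjective i j D
  exact ⟨D, by rw [map_mul, ← hD, map_sub]; rfl⟩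

/-- The divided difference of an element of `A^{i,j}` invariant under `w ↦ −w`. -/
lemma exists_divided_difference_of_odd [Invertible (2 : k)] {i j : I}
    {q : FreeAlgebra k (Fin 2)} (hq : mkA2 k I podd i j (negW k q) = mkA2 k I podd i j q) :
    ∃ D, mkA3 k I podd i j (D * (ι k 2 * ι k 2 - ι k 0 * ι k 0)) =
      mkA3 k I podd i j (sub21 k q - sub01 k q) := by
  obtain ⟨u, hu⟩ := exists_mkA2_eq_sqW hq
  have h21 := eq_of_mkA2_eq ((mkA3 k I podd i j).comp (sub21 k)) (by
    have h := mkA3_mul (k := k) (podd := podd) i j (s := 1) (t := 2) (by decide)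
    simp only [AlgHom.comp_apply, sub21_zero, sub21_one, h]
    simp only [if_true, show (2 : Fin 3) ≠ 1 by decide, if_false]
    by_cases h1 : podd i <;> by_cases h2 : podd j <;> simp [h1, h2]) hu
  have h01 := eq_of_mkA2_eq ((mkA3 k I podd i j).comp (sub01 k)) (by
    have h := mkA3_mul (k := k) (podd := podd) i j (s := 0) (t := 1) (by decide)
    simp only [AlgHom.comp_apply, sub01_zero, sub01_one, h]
    simp only [if_true, show (0 : Fin 3) ≠ 1 by decide, if_false]) hu
  obtain ⟨D, hD⟩ := exists_sub_eq_mul (((mkA3 k I podd i j).comp (sub21 k)).comp (sqW k))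
    (((mkA3 k I podd i j).comp (sub01 k)).comp (sqW k))
    (c := mkA3 k I podd i j (ι k 2 * ι k 2 - ι k 0 * ι k 0))
    (commute_of_commute_gen (mkA3_surjective i j) fun t => by
      rw [map_sub]
      exact (mkA3_sq_commute i j t 2).sub_left (mkA3_sq_commute i j t 0))
    (fun t => by
      fin_cases t
      · exact ⟨1, by simp⟩
      · exact ⟨0, by simp⟩) u
  obtain ⟨D, rfl⟩ := mkA3_surjective i j D
  refine ⟨D, ?_⟩
  rw [map_mul, ← hD, map_sub]
  exact congrArg₂ (· - ·) h21.symm h01.symm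

end SkewPolynomials

section Matsumoto

variable {n}

lemma reduced_of_wordPerm_eq {l l' : List (Fin (n - 1))} (h : Reduced l)
    (hw : wordPerm l' = wordPerm l) (hl : l'.length = l.length) : Reduced l' := by
  rw [Reduced, hw, hl]; exact h

lemma sperm_comm {a b : Fin (n - 1)} (h : (a : ℕ) + 1 < b ∨ (b : ℕ) + 1 < a) :
    sperm a * sperm b = sperm b * sperm a := by
  apply Equiv.Perm.Disjoint.commute
  rw [Equiv.Perm.disjoint_iff_eq_or_eq]
  intro x
  simp only [sperm, Equiv.swap_apply_def, lo, hi, Fin.ext_iff]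
  split_ifs <;> simp_all <;> omega

lemma sperm_braid {a b : Fin (n - 1)} (h : (b : ℕ) = a + 1) :
    sperm a * sperm b * sperm a = sperm b * sperm a * sperm b := by
  have e : hi a = lo b := Fin.ext (by simp [lo, hi, h])
  have h1 : lo a ≠ hi b := by simp [lo, hi, Fin.ext_iff]; omega
  have h2 := lo_ne_hi a
  have h3 := lo_ne_hi b
  have hb := Equiv.swap_mul_swap_mul_swap (e ▸ h2) h1
  have ha := Equiv.swap_mul_swap_mul_swap h3.symm h1.symm
  rw [sperm, sperm, e, hb, Equiv.swap_comm (hi b), ← ha, Equiv.swap_comm (lo b) (lo a),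
    Equiv.swap_comm (hi b)]

/-- Matsumoto's theorem: two reduced words of a permutation are related by braid moves. -/
theorem rel_of_reduced {r : List (Fin (n - 1)) → List (Fin (n - 1)) → Prop}
    (refl : ∀ l, r l l) (trans : ∀ {l l' l''}, r l l' → r l' l'' → r l l'')
    (cons : ∀ a {l l'}, r l l' → r (a :: l) (a :: l'))
    (far : ∀ (a b : Fin (n - 1)) u, ((a : ℕ) + 1 < b ∨ (b : ℕ) + 1 < a) → r (a :: b :: u) (b :: a :: u))
    (braid : ∀ (a b : Fin (n - 1)) u, ((b : ℕ) = a + 1 ∨ (a : ℕ) = b + 1) →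
      r (a :: b :: a :: u) (b :: a :: b :: u))
    {l l' : List (Fin (n - 1))} (hl : Reduced l) (hl' : Reduced l')
    (hw : wordPerm l = wordPerm l') : r l l' := by
  have hlen : l.length = l'.length := by rw [← hl, ← hl', hw]
  induction hN : l.length using Nat.strong_induction_on generalizing l l' with
  | _ N ih =>
  subst hN
  match l, l' with
  | [], [] => exact refl _
  | [], _ :: _ => simp at hlen
  | _ :: _, [] => simp at hlen
  | a :: l, b :: l' =>
    have ih' : ∀ {m m'}, m.length = l.length → Reduced m → Reduced m' →
        wordPerm m = wordPerm m' → r m m' := fun {m m'} h hm hm' hmm' =>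
      ih m.length (by simp [h]) hm hm' hmm' (by rw [← hm, ← hm', hmm']) rfl
    have hda := hl.descent
    have hdb := hl'.descent
    rw [← hw] at hdb
    set w := wordPerm (a :: l) with hwdef
    have hwl : (wordPerm l)⁻¹ = w⁻¹ * sperm a := by
      rw [hwdef, wordPerm_cons, mul_inv_rev, sperm_inv, mul_assoc, sperm_mul_self, mul_one]
    have hlt := hl.lt
    rcases lt_trichotomy (a : ℕ) b with hab | hab | hab
    rotate_left
    · obtain rfl : a = b := Fin.ext hab
      refine cons a (ih' rfl hl.tail hl'.tail ?_)
      simpa [hwdef] using hw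
    all_goals
      by_cases hadj : (b : ℕ) = a + 1 ∨ (a : ℕ) = b + 1
      · -- adjacent letters
        obtain ⟨m, hm, hmr⟩ := exists_reduced_cons (w := wordPerm l) (a := b) (by
          rw [hwl]
          simp only [Equiv.Perm.mul_apply]
          rcases hadj with hadj | hadj
          · have e1 : hi a = lo b := Fin.ext (by simp [lo, hi, hadj])
            rw [sperm_of_ne (p := hi b) (by simp [lo, hi, Fin.ext_iff]; omega)
              (by simp [hi, Fin.ext_iff]; omega), ← e1, sperm_hi]
            rw [e1] at hda
            exact hdb.trans hda
          · have e1 : hi b = lo a := Fin.ext (by simp [lo, hi, hadj])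
            rw [sperm_of_ne (p := lo b) (by simp [lo, Fin.ext_iff]; omega)
              (by simp [lo, hi, Fin.ext_iff]; omega), e1, sperm_lo]
            rw [e1] at hdb
            exact hda.trans hdb)
        have hwm : (wordPerm m)⁻¹ = w⁻¹ * sperm a * sperm b := by
          rw [← hwl, ← hm, wordPerm_cons, mul_inv_rev, sperm_inv, mul_assoc, sperm_mul_self,
            mul_one]
        obtain ⟨u, hu, hur⟩ := exists_reduced_cons (w := wordPerm m) (a := a) (by
          rw [hwm]
          simp only [Equiv.Perm.mul_apply]
          rcases hadj with hadj | hadj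
          · have e1 : hi a = lo b := Fin.ext (by simp [lo, hi, hadj])
            rw [sperm_of_ne (a := b) (p := lo a) (by simp [lo, Fin.ext_iff]; omega)
              (by simp [lo, hi, Fin.ext_iff]; omega), e1, sperm_lo, sperm_lo,
              sperm_of_ne (p := hi b) (by simp [lo, hi, Fin.ext_iff]; omega)
              (by simp [hi, Fin.ext_iff]; omega), e1]
            exact hdb
          · have e1 : hi b = lo a := Fin.ext (by simp [lo, hi, hadj])
            rw [sperm_of_ne (a := b) (p := hi a) (by simp [lo, hi, Fin.ext_iff]; omega)
              (by simp [hi, Fin.ext_iff]; omega), ← e1, sperm_hi, sperm_hi,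
              sperm_of_ne (p := lo b) (by simp [lo, Fin.ext_iff]; omega)
              (by simp [lo, hi, Fin.ext_iff]; omega), ← e1]
            exact hdb)
        have hlb : (b :: m).length = l.length := by rw [← hmr, ← hl.tail, hm]
        have hma : (a :: u).length = m.length := by rw [← hur, ← hmr.tail, hu]
        have hbr : sperm a * sperm b * sperm a = sperm b * sperm a * sperm b := by
          rcases hadj with hadj | hadj
          · exact sperm_braid hadj
          · exact (sperm_braid hadj).symm
        have hw1 : wordPerm (a :: b :: u) = wordPerm l' := by
          have : w = sperm a * sperm b * sperm a * wordPerm u := by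
            rw [hwdef, wordPerm_cons, ← hm, wordPerm_cons, ← hu, wordPerm_cons]
            simp only [mul_assoc]
          rw [hw, hbr, wordPerm_cons] at this
          simpa [mul_assoc] using this.symm
        have hm' : r (b :: m) (b :: a :: u) :=
          cons b (ih m.length (by simp at hlb ⊢; omega) hmr.tail hur hu.symm hma.symm rfl)
        refine trans (cons a (trans (ih' rfl hl.tail hmr hm.symm) hm')) ?_
        refine trans (braid a b u hadj) (cons b (ih' ?_ ?_ hl'.tail hw1))
        · simp only [List.length_cons] at *; omega
        · refine reduced_of_wordPerm_eq hl'.tail hw1 ?_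
          simp only [List.length_cons] at *; omega
      · have hfar : (a : ℕ) + 1 < b ∨ (b : ℕ) + 1 < a := by omega
        obtain ⟨u, hu, hur⟩ := exists_reduced_cons (w := wordPerm l) (a := b) (by
          rw [hwl]
          simp only [Equiv.Perm.mul_apply]
          rwa [sperm_of_ne (p := hi b) (by simp [lo, hi, Fin.ext_iff]; omega)
              (by simp [hi, Fin.ext_iff]; omega), sperm_of_ne (p := lo b)
              (by simp [lo, Fin.ext_iff]; omega) (by simp [lo, hi, Fin.ext_iff]; omega)])
        have hlb : (b :: u).length = l.length := by rw [← hur, ← hl.tail, hu]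
        have hw1 : wordPerm (a :: u) = wordPerm l' := by
          have : w = sperm a * sperm b * wordPerm u := by
            rw [hwdef, wordPerm_cons, ← hu, wordPerm_cons]
            simp only [mul_assoc]
          rw [hw, sperm_comm hfar, wordPerm_cons] at this
          simpa [mul_assoc] using this.symm
        refine trans (cons a (ih' rfl hl.tail hur hu.symm)) ?_
        refine trans (far a b u hfar) (cons b (ih' ?_ ?_ hl'.tail hw1))
        · simp only [List.length_cons] at *; omega
        · refine reduced_of_wordPerm_eq hl'.tail hw1 ?_
          simp only [List.length_cons] at *; omega

/-- A word that is not reduced can be transformed by braid moves into one with a repeated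
letter. -/
theorem of_not_reduced {r : List (Fin (n - 1)) → List (Fin (n - 1)) → Prop}
    {P : List (Fin (n - 1)) → Prop}
    (hr : ∀ {l l'}, Reduced l → Reduced l' → wordPerm l = wordPerm l' → r l l')
    (cons : ∀ a {l}, P l → P (a :: l))
    (rel : ∀ a {l u}, r l (a :: u) → P (a :: l))
    {l : List (Fin (n - 1))} (hl : ¬ Reduced l) : P l := by
  induction l with
  | nil => exact absurd (by simp [Reduced]) hl
  | cons a l ih =>
    by_cases h : Reduced l
    · rw [reduced_cons_iff, not_and] at hl
      obtain ⟨u, hu, hur⟩ := exists_reduced_cons (w := wordPerm l) (a := a)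
        ((lo_lt_or_gt _ a).resolve_left (hl h))
      exact rel a (hr h hur hu.symm)
    · exact cons a (ih h)

end Matsumoto

section Spanning

variable {k I podd n} {A : Type*} [Ring A] [Algebra k A] (φ : RFree k I n →ₐ[k] A)

/-- The subalgebra generated by the images of the `x_p` and `e(ν)`. -/
def polySubalgebra : Subalgebra k A :=
  Algebra.adjoin k (Set.range (fun p => φ (xF k I n p)) ∪ Set.range (fun ν => φ (eF k I n ν)))

lemma x_mem (p : Fin n) : φ (xF k I n p) ∈ polySubalgebra φ :=
  Algebra.subset_adjoin (Or.inl ⟨p, rfl⟩)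

lemma e_mem (ν : Fin n → I) : φ (eF k I n ν) ∈ polySubalgebra φ :=
  Algebra.subset_adjoin (Or.inr ⟨ν, rfl⟩)

lemma lift_mem {X : Type*} {f : X → RFree k I n} (hf : ∀ t, φ (f t) ∈ polySubalgebra φ)
    (q : FreeAlgebra k X) : φ (FreeAlgebra.lift k f q) ∈ polySubalgebra φ := by
  induction q using FreeAlgebra.induction with
  | grade0 r => simp
  | grade1 t => simpa using hf t
  | mul a b ha hb => rw [map_mul, map_mul]; exact mul_mem ha hb
  | add a b ha hb => rw [map_add, map_add]; exact add_mem ha hb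

/-- The product of the images of the `τ_a` along a word. -/
def tauWord (l : List (Fin (n - 1))) : A := (l.map fun a => φ (tauF k I n a)).prod

lemma tauWord_cons (a : Fin (n - 1)) (l : List (Fin (n - 1))) :
    tauWord φ (a :: l) = φ (tauF k I n a) * tauWord φ l := by simp [tauWord]

lemma tauWord_nil : tauWord φ [] = 1 := rfl

/-- The span of the products of a polynomial with a word of length less than `m` in the
`τ_a`. -/
def lengthFiltration (m : ℕ) : Submodule k A :=
  Submodule.span k {z | ∃ y ∈ polySubalgebra φ, ∃ l, l.length < m ∧ z = y * tauWord φ l}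

variable {φ}

lemma mul_tauWord_mem {y : A} (hy : y ∈ polySubalgebra φ) {l : List (Fin (n - 1))} {m : ℕ}
    (h : l.length < m) : y * tauWord φ l ∈ lengthFiltration φ m :=
  Submodule.subset_span ⟨y, hy, l, h, rfl⟩

lemma tauWord_mem {l : List (Fin (n - 1))} {m : ℕ}
    (h : l.length < m) : tauWord φ l ∈ lengthFiltration φ m := by
  simpa using mul_tauWord_mem (one_mem (polySubalgebra φ)) h

lemma lengthFiltration_mono : Monotone (lengthFiltration φ) := fun _ _ h =>
  Submodule.span_mono fun _ ⟨y, hy, l, hl, hz⟩ => ⟨y, hy, l, hl.trans_le h, hz⟩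

lemma mul_mem_lengthFiltration {y z : A} (hy : y ∈ polySubalgebra φ) {m : ℕ}
    (hz : z ∈ lengthFiltration φ m) : y * z ∈ lengthFiltration φ m := by
  induction hz using Submodule.span_induction with
  | mem z hz =>
    obtain ⟨y', hy', l, hl, rfl⟩ := hz
    rw [← mul_assoc]
    exact mul_tauWord_mem (mul_mem hy hy') hl
  | zero => simp
  | add z z' _ _ h h' => rw [mul_add]; exact add_mem h h'
  | smul c z _ h => rw [mul_smul_comm]; exact Submodule.smul_mem _ _ h

variable {Qrep : I → I → FreeAlgebra k (Fin 2)}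
  (hφ : ∀ ⦃a b⦄, RRel k I podd n Qrep a b → φ a = φ b)

include hφ

lemma sum_e_eq_one : ∑ ν, φ (eF k I n ν) = 1 := by
  simpa using hφ RRel.e_sum

lemma mem_of_forall_mul_e_mem {S : Submodule k A} {u : A}
    (h : ∀ ν, u * φ (eF k I n ν) ∈ S) : u ∈ S := by
  rw [← mul_one u, ← sum_e_eq_one hφ, Finset.mul_sum]
  exact Submodule.sum_mem _ fun ν _ => h ν

lemma tau_mul_e (a : Fin (n - 1)) (ν : Fin n → I) :
    φ (tauF k I n a) * φ (eF k I n ν) =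
      φ (eF k I n (fun p => ν (sperm a p))) * φ (tauF k I n a) := by
  simpa using hφ (RRel.taue a ν)

lemma x_mul_e (p : Fin n) (ν : Fin n → I) :
    φ (xF k I n p) * φ (eF k I n ν) = φ (eF k I n ν) * φ (xF k I n p) := by
  simpa using hφ (RRel.xe p ν)

lemma e_mul_tauWord (l : List (Fin (n - 1))) (ν : Fin n → I) :
    ∃ ν', φ (eF k I n ν) * tauWord φ l = tauWord φ l * φ (eF k I n ν') := by
  induction l generalizing ν with
  | nil => exact ⟨ν, by simp [tauWord_nil]⟩
  | cons a l ih =>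
    obtain ⟨ν', h⟩ := ih (fun p => ν (sperm a p))
    refine ⟨ν', ?_⟩
    have := tau_mul_e hφ a (fun p => ν (sperm a p))
    simp only [sperm_sperm] at this
    rw [tauWord_cons, ← mul_assoc, ← this, mul_assoc, h, mul_assoc]

omit hφ in
lemma mem_map_mulRight {t u : A} :
    u ∈ (Subalgebra.toSubmodule (polySubalgebra φ)).map (LinearMap.mulRight k t) ↔
      ∃ y ∈ polySubalgebra φ, y * t = u := by
  simp [Submodule.mem_map]

lemma tau_mul_mem (b : Fin (n - 1)) {y : A} (hy : y ∈ polySubalgebra φ) :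
    ∃ y' ∈ polySubalgebra φ, ∃ y'' ∈ polySubalgebra φ,
      φ (tauF k I n b) * y = y' * φ (tauF k I n b) + y'' := by
  set t := φ (tauF k I n b) with ht
  let S := (Subalgebra.toSubmodule (polySubalgebra φ)).map (LinearMap.mulRight k t) ⊔
    Subalgebra.toSubmodule (polySubalgebra φ)
  have hS : ∀ u, u ∈ S ↔ ∃ y' ∈ polySubalgebra φ, ∃ y'' ∈ polySubalgebra φ,
      u = y' * t + y'' := fun u => by
    simp only [S, Submodule.mem_sup, mem_map_mulRight, Subalgebra.mem_toSubmodule]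
    constructor
    · rintro ⟨_, ⟨y', hy', rfl⟩, y'', hy'', rfl⟩; exact ⟨y', hy', y'', hy'', rfl⟩
    · rintro ⟨y', hy', y'', hy'', rfl⟩; exact ⟨_, ⟨y', hy', rfl⟩, y'', hy'', rfl⟩
  have hPS : ∀ {y u}, y ∈ polySubalgebra φ → u ∈ S → y * u ∈ S := by
    intro y u hy hu
    obtain ⟨y', hy', y'', hy'', rfl⟩ := (hS u).1 hu
    exact (hS _).2 ⟨y * y', mul_mem hy hy', y * y'', mul_mem hy hy'', by
      rw [mul_add, mul_assoc]⟩
  have hyS : ∀ {y}, y ∈ polySubalgebra φ → y ∈ S := fun {y} hy =>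
    (hS y).2 ⟨0, zero_mem _, y, hy, by simp⟩
  have hte : ∀ ν, t * φ (eF k I n ν) ∈ S := fun ν => by
    rw [ht, tau_mul_e hφ, ← ht]
    exact (hS _).2 ⟨_, e_mem φ _, 0, zero_mem _, (add_zero _).symm⟩
  rw [← hS]
  induction hy using Algebra.adjoin_induction with
  | mem z hz =>
    rcases hz with ⟨p, rfl⟩ | ⟨ν, rfl⟩
    · refine mem_of_forall_mul_e_mem hφ fun ν => ?_
      by_cases h1 : p = lo b
      · subst h1
        have h := hφ (RRel.taux2 b ν)
        simp only [map_sub, map_mul, ← ht] at h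
        have hδ : φ (if ν (lo b) = ν (hi b) then eF k I n ν else 0) ∈ S := by
          split_ifs
          · exact hyS (e_mem φ ν)
          · simp
        have hx : φ (xF k I n (hi b)) * t * φ (eF k I n ν) ∈ S := by
          rw [mul_assoc]; exact hPS (x_mem φ _) (hte ν)
        rw [← h] at hδ
        have h3 := sub_mem hx hδ
        rw [sub_sub_cancel] at h3
        split_ifs at h3
        · simpa [ht] using h3
        · simpa [ht] using h3
      · by_cases h2 : p = hi b
        · subst h2
          have h := hφ (RRel.taux1 b ν)
          simp only [map_sub, map_mul, ← ht] at h
          rw [sub_eq_iff_eq_add] at h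
          simp only at h ⊢
          rw [h]
          refine add_mem ?_ ?_
          · split_ifs
            · exact hyS (e_mem φ ν)
            · simp
          · split_ifs
            · simp only [map_neg, map_mul, ← ht, mul_assoc]
              exact neg_mem (hPS (x_mem φ _) (hte ν))
            · simp only [map_mul, ← ht, mul_assoc]
              exact hPS (x_mem φ _) (hte ν)
        · have h := hφ (RRel.taux b p ν h1 h2)
          simp only [map_mul, ← ht] at h
          rw [h]
          split_ifs
          · simp only [map_neg, map_mul, ← ht, mul_assoc]
            exact neg_mem (hPS (x_mem φ _) (hte ν))
          · simp only [map_mul, ← ht, mul_assoc]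
            exact hPS (x_mem φ _) (hte ν)
    · exact hte ν
  | algebraMap r =>
    rw [← Algebra.commutes]
    exact (hS _).2 ⟨_, algebraMap_mem _ r, 0, zero_mem _, by simp⟩
  | add y z _ _ h h' => rw [mul_add]; exact add_mem h h'
  | mul y z _ hz h h' =>
    obtain ⟨y', hy', y'', hy'', e⟩ := (hS _).1 h
    rw [← mul_assoc, e, add_mul, mul_assoc]
    exact add_mem (hPS hy' h') (hyS (mul_mem hy'' hz))

lemma tau_mul_mem_lengthFiltration (b : Fin (n - 1)) {z : A} {m : ℕ}
    (hz : z ∈ lengthFiltration φ m) : φ (tauF k I n b) * z ∈ lengthFiltration φ (m + 1) := by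
  induction hz using Submodule.span_induction with
  | mem z hz =>
    obtain ⟨y, hy, l, hl, rfl⟩ := hz
    obtain ⟨y', hy', y'', hy'', e⟩ := tau_mul_mem hφ b hy
    rw [← mul_assoc, e, add_mul, mul_assoc, ← tauWord_cons]
    exact add_mem (mul_tauWord_mem hy' (by simpa using hl)) (mul_tauWord_mem hy'' (by omega))
  | zero => simp
  | add z z' _ _ h h' => rw [mul_add]; exact add_mem h h'
  | smul c z _ h => rw [mul_smul_comm]; exact Submodule.smul_mem _ _ h

lemma tau_mul_self_mem (a : Fin (n - 1)) :
    φ (tauF k I n a) * φ (tauF k I n a) ∈ polySubalgebra φ := by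
  rw [← Subalgebra.mem_toSubmodule]
  refine mem_of_forall_mul_e_mem hφ fun ν => ?_
  have h := hφ (RRel.tausq a ν)
  simp only [map_mul] at h
  rw [h]
  refine (polySubalgebra φ).mul_mem (lift_mem φ (fun t => ?_) _) (e_mem φ ν)
  split_ifs <;> exact x_mem φ _

lemma tau_mul_tau_far {a b : Fin (n - 1)} (h : (a : ℕ) + 1 < b ∨ (b : ℕ) + 1 < a) :
    ∃ y ∈ polySubalgebra φ, y * (φ (tauF k I n b) * φ (tauF k I n a)) =
      φ (tauF k I n a) * φ (tauF k I n b) := by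
  rw [← mem_map_mulRight]
  refine mem_of_forall_mul_e_mem hφ fun ν => ?_
  have h := hφ (RRel.tautau a b ν h)
  simp only [map_mul] at h
  have h' : φ (tauF k I n b) * φ (tauF k I n a) * φ (eF k I n ν) ∈
      (Subalgebra.toSubmodule (polySubalgebra φ)).map
        (LinearMap.mulRight k (φ (tauF k I n b) * φ (tauF k I n a))) := by
    rw [mem_map_mulRight]
    refine ⟨_, e_mem φ (fun p => ν (sperm a (sperm b p))), ?_⟩
    rw [mul_assoc, tau_mul_e hφ, ← mul_assoc, ← mul_assoc, tau_mul_e hφ]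
  rw [h]
  split_ifs
  · simpa using h'
  · simpa using h'

lemma tau_braid_mem [Invertible (2 : k)] (hQ : QConds k I podd Qrep) {a b : Fin (n - 1)}
    (hab : (b : ℕ) = a + 1) :
    φ (tauF k I n b) * φ (tauF k I n a) * φ (tauF k I n b) -
      φ (tauF k I n a) * φ (tauF k I n b) * φ (tauF k I n a) ∈ polySubalgebra φ := by
  rw [← Subalgebra.mem_toSubmodule]
  refine mem_of_forall_mul_e_mem hφ fun ν => ?_
  rw [sub_mul]
  have hD : ∀ D, φ (evalX3 k I n a b D) ∈ polySubalgebra φ := fun D =>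
    lift_mem φ (fun t => by split_ifs <;> exact x_mem φ _) D
  by_cases hs : ν (lo a) = ν (hi b)
  · cases hp : podd (ν (lo a)) with
    | false =>
      obtain ⟨D, hD'⟩ := exists_divided_difference_of_even hp (ν (hi a))
        (Qrep (ν (lo a)) (ν (hi a)))
      have h := hφ (RRel.braid_even a b hab ν hs hp D hD')
      simp only [map_sub, map_mul] at h
      rw [h]
      exact (polySubalgebra φ).mul_mem (hD D) (e_mem φ ν)
    | true =>
      obtain ⟨D, hD'⟩ := exists_divided_difference_of_odd
        (hQ.even (ν (lo a)) (ν (hi a)) hp)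
      have h := hφ (RRel.braid_odd a b hab ν hs hp D hD')
      simp only [map_sub, map_mul] at h
      have h' : φ ((xF k I n (hi b) - xF k I n (lo a)) * evalX3 k I n a b D * eF k I n ν) ∈
          polySubalgebra φ := by
        simp only [map_sub, map_mul]
        exact mul_mem (mul_mem (sub_mem (x_mem φ _) (x_mem φ _)) (hD D)) (e_mem φ ν)
      rw [h]
      split_ifs
      · rw [map_neg]; exact neg_mem h'
      · exact h'
  · have h := hφ (RRel.braid_zero a b hab ν hs)
    simp only [map_sub, map_mul, map_zero] at h
    rw [h]
    exact zero_mem _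

/-- Congruence of words up to polynomial coefficients and shorter words. -/
def WordRel (φ : RFree k I n →ₐ[k] A) (l l' : List (Fin (n - 1))) : Prop :=
  l.length = l'.length ∧
    ∃ y ∈ polySubalgebra φ, tauWord φ l - y * tauWord φ l' ∈ lengthFiltration φ l.length

omit hφ in
lemma WordRel.trans {l l' l'' : List (Fin (n - 1))} (h : WordRel φ l l')
    (h' : WordRel φ l' l'') : WordRel φ l l'' := by
  obtain ⟨e, y, hy, hm⟩ := h
  obtain ⟨e', y', hy', hm'⟩ := h'
  refine ⟨e.trans e', y * y', mul_mem hy hy', ?_⟩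
  rw [← e] at hm'
  have := add_mem hm (mul_mem_lengthFiltration hy hm')
  rwa [mul_sub, sub_add_sub_cancel, ← mul_assoc] at this

lemma WordRel.cons (a : Fin (n - 1)) {l l' : List (Fin (n - 1))} (h : WordRel φ l l') :
    WordRel φ (a :: l) (a :: l') := by
  obtain ⟨e, y, hy, hm⟩ := h
  obtain ⟨y', hy', y'', hy'', e'⟩ := tau_mul_mem hφ a hy
  refine ⟨by simp [e], y', hy', ?_⟩
  have h1 := tau_mul_mem_lengthFiltration hφ a hm
  have h2 : y'' * tauWord φ l' ∈ lengthFiltration φ (l.length + 1) :=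
    mul_tauWord_mem hy'' (by omega)
  have := add_mem h1 h2
  rw [mul_sub, ← mul_assoc, e', add_mul, ← sub_sub, sub_add_cancel, mul_assoc] at this
  simpa [tauWord_cons] using this

lemma wordRel_far {a b : Fin (n - 1)} (u : List (Fin (n - 1)))
    (h : (a : ℕ) + 1 < b ∨ (b : ℕ) + 1 < a) :
    WordRel φ (a :: b :: u) (b :: a :: u) := by
  obtain ⟨y, hy, e⟩ := tau_mul_tau_far hφ h
  refine ⟨rfl, y, hy, ?_⟩
  have : tauWord φ (a :: b :: u) = y * tauWord φ (b :: a :: u) := by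
    simp only [tauWord_cons, ← mul_assoc, ← e]
  rw [this, sub_self]
  exact zero_mem _

lemma wordRel_braid [Invertible (2 : k)] (hQ : QConds k I podd Qrep) {a b : Fin (n - 1)}
    (u : List (Fin (n - 1))) (h : (b : ℕ) = a + 1 ∨ (a : ℕ) = b + 1) :
    WordRel φ (a :: b :: a :: u) (b :: a :: b :: u) := by
  refine ⟨rfl, 1, one_mem _, ?_⟩
  have key : ∀ {c d : Fin (n - 1)}, (d : ℕ) = c + 1 →
      tauWord φ (d :: c :: d :: u) - tauWord φ (c :: d :: c :: u) ∈
        lengthFiltration φ (a :: b :: a :: u).length := fun {c d} hcd => by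
    have := mul_tauWord_mem (tau_braid_mem hφ hQ hcd) (l := u)
      (m := (a :: b :: a :: u).length) (by simp; omega)
    simpa only [tauWord_cons, sub_mul, mul_assoc] using this
  rw [one_mul]
  rcases h with h | h
  · rw [← neg_sub]; exact neg_mem (key h)
  · exact key h

lemma wordRel_of_reduced [Invertible (2 : k)] (hQ : QConds k I podd Qrep)
    {l l' : List (Fin (n - 1))} (hl : Reduced l) (hl' : Reduced l')
    (hw : wordPerm l = wordPerm l') : WordRel φ l l' :=
  rel_of_reduced (fun l => ⟨rfl, 1, one_mem _, by simp⟩)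
    (fun h h' => h.trans h') (fun a _ _ h => h.cons hφ a)
    (fun _ _ u h => wordRel_far hφ u h) (fun _ _ u h => wordRel_braid hφ hQ u h) hl hl' hw

lemma tauWord_mem_of_not_reduced [Invertible (2 : k)] (hQ : QConds k I podd Qrep)
    {l : List (Fin (n - 1))} (hl : ¬ Reduced l) : tauWord φ l ∈ lengthFiltration φ l.length := by
  refine of_not_reduced (r := WordRel φ) (P := fun l => tauWord φ l ∈ lengthFiltration φ l.length)
    (wordRel_of_reduced hφ hQ) (fun a l h => ?_) (fun a l u h => ?_) hl
  · rw [tauWord_cons]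
    exact tau_mul_mem_lengthFiltration hφ a h
  · obtain ⟨e, y, hy, hm⟩ := h
    obtain ⟨y', hy', y'', hy'', e'⟩ := tau_mul_mem hφ a hy
    have h1 := tau_mul_mem_lengthFiltration hφ a hm
    simp only [List.length_cons] at e
    have h2 : φ (tauF k I n a) * (y * tauWord φ (a :: u)) ∈
        lengthFiltration φ (l.length + 1) := by
      rw [← mul_assoc, e', add_mul]
      refine add_mem ?_ (mul_tauWord_mem hy'' (by simp [e]))
      rw [tauWord_cons, mul_assoc, ← mul_assoc (φ (tauF k I n a)), ← mul_assoc]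
      exact mul_tauWord_mem (mul_mem hy' (tau_mul_self_mem hφ a)) (by omega)
    have := add_mem h1 h2
    rw [mul_sub, sub_add_cancel] at this
    simpa [tauWord_cons] using this

lemma x_mul_x_pow_mul_e (p q : Fin n) (m : ℕ) (ν : Fin n → I) :
    ∃ ε : k, φ (xF k I n p) * φ (xF k I n q) ^ m * φ (eF k I n ν) =
      ε • (φ (xF k I n q) ^ m * φ (xF k I n p) * φ (eF k I n ν)) := by
  induction m with
  | zero => exact ⟨1, by simp⟩
  | succ m ih =>
    obtain ⟨ε, h⟩ := ih
    obtain ⟨ε', h'⟩ : ∃ ε' : k, φ (xF k I n p) * φ (xF k I n q) * φ (eF k I n ν) =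
        ε' • (φ (xF k I n q) * φ (xF k I n p) * φ (eF k I n ν)) := by
      have h' := hφ (RRel.xx p q ν)
      simp only [map_mul] at h'
      rw [h']
      split_ifs
      · exact ⟨-1, by simp⟩
      · exact ⟨1, by simp⟩
    refine ⟨ε * ε', ?_⟩
    rw [pow_succ, ← mul_assoc, mul_assoc _ (φ (xF k I n q)), x_mul_e hφ, ← mul_assoc, h,
      smul_mul_assoc, mul_assoc, ← x_mul_e hφ, mul_assoc (_ ^ m), ← mul_assoc (φ (xF k I n p)),
      h', mul_smul_comm, smul_smul]
    simp only [mul_assoc]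

variable (φ) in
omit hφ in
/-- The ordered monomial in the images of the `x_p`, `p` running through `l`. -/
def xMonomial (l : List (Fin n)) (a : Fin n → ℕ) : A :=
  (l.map fun q => φ (xF k I n q) ^ a q).prod

lemma xMonomial_mul_e (l : List (Fin n)) (a : Fin n → ℕ) (ν : Fin n → I) :
    xMonomial φ l a * φ (eF k I n ν) = φ (eF k I n ν) * xMonomial φ l a := by
  refine Commute.list_prod_left _ _ fun z hz => ?_
  obtain ⟨q, -, rfl⟩ := List.mem_map.1 hz
  exact Commute.pow_left (x_mul_e hφ q ν) _

omit hφ in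
lemma xMonomial_congr {l : List (Fin n)} {a b : Fin n → ℕ} (h : ∀ q ∈ l, a q = b q) :
    xMonomial φ l a = xMonomial φ l b := by
  rw [xMonomial, xMonomial, List.map_congr_left fun q hq => by rw [h q hq]]

lemma x_mul_xMonomial_mul_e {l : List (Fin n)} (hl : l.Nodup) {p : Fin n} (hp : p ∈ l)
    (a : Fin n → ℕ) (ν : Fin n → I) :
    ∃ ε : k, φ (xF k I n p) * xMonomial φ l a * φ (eF k I n ν) =
      ε • (xMonomial φ l (a + Pi.single p 1) * φ (eF k I n ν)) := by
  induction l with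
  | nil => simp at hp
  | cons q l ih =>
    have hcons : ∀ a : Fin n → ℕ, xMonomial φ (q :: l) a =
        φ (xF k I n q) ^ a q * xMonomial φ l a := fun a => by simp [xMonomial]
    rw [List.nodup_cons] at hl
    by_cases hpq : p = q
    · subst hpq
      refine ⟨1, ?_⟩
      rw [one_smul, hcons, hcons, xMonomial_congr (a := a + Pi.single p 1) (b := a) fun q hq => by
        have : q ≠ p := fun h => hl.1 (h ▸ hq)
        simp [this]]
      simp [pow_succ', mul_assoc]
    · have hp' : p ∈ l := by simpa [hpq] using hp
      obtain ⟨ε, h⟩ := ih hl.2 hp'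
      obtain ⟨ε', h'⟩ := x_mul_x_pow_mul_e hφ p q (a q) ν
      refine ⟨ε' * ε, ?_⟩
      have hq : (a + Pi.single p 1 : Fin n → ℕ) q = a q := by simp [Ne.symm hpq]
      rw [hcons, hcons, hq, mul_assoc, mul_assoc, xMonomial_mul_e hφ, ← mul_assoc (_ ^ a q),
        ← mul_assoc, ← mul_assoc, h', smul_mul_assoc, mul_assoc, ← xMonomial_mul_e hφ,
        mul_assoc, ← mul_assoc (φ (xF k I n p)), h, mul_smul_comm, smul_smul, mul_assoc]

lemma e_mul_e (μ ν : Fin n → I) :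
    φ (eF k I n μ) * φ (eF k I n ν) = if μ = ν then φ (eF k I n ν) else 0 := by
  split_ifs with h
  · subst h
    simpa using hφ (RRel.e_idem μ)
  · simpa using hφ (RRel.e_orth μ ν h)

lemma mem_span_xMonomial {y : A} (hy : y ∈ polySubalgebra φ) :
    y ∈ Submodule.span k (Set.range fun t : (Fin n → ℕ) × (Fin n → I) =>
      xMonomial φ (List.finRange n) t.1 * φ (eF k I n t.2)) := by
  set S := Submodule.span k (Set.range fun t : (Fin n → ℕ) × (Fin n → I) =>
      xMonomial φ (List.finRange n) t.1 * φ (eF k I n t.2)) with hS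
  have hmem : ∀ a ν, xMonomial φ (List.finRange n) a * φ (eF k I n ν) ∈ S := fun a ν =>
    Submodule.subset_span ⟨(a, ν), rfl⟩
  suffices h : ∀ z ∈ S, y * z ∈ S by
    rw [← mul_one y]
    refine h 1 (mem_of_forall_mul_e_mem hφ fun ν => ?_)
    have h0 : xMonomial φ (List.finRange n) 0 = 1 := by simp [xMonomial]
    rw [← h0]
    exact hmem 0 ν
  induction hy using Algebra.adjoin_induction with
  | mem y hy =>
    intro z hz
    induction hz using Submodule.span_induction with
    | mem z hz =>
      obtain ⟨⟨a, ν⟩, rfl⟩ := hz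
      rcases hy with ⟨p, rfl⟩ | ⟨μ, rfl⟩
      · obtain ⟨ε, h⟩ := x_mul_xMonomial_mul_e hφ (List.nodup_finRange n)
          (List.mem_finRange p) a ν
        simp only [← mul_assoc]
        rw [h]
        exact S.smul_mem _ (hmem _ _)
      · simp only [← mul_assoc]
        rw [← xMonomial_mul_e hφ, mul_assoc, e_mul_e hφ]
        split_ifs
        · exact hmem _ _
        · simp
    | zero => simp
    | add z z' _ _ h h' => rw [mul_add]; exact add_mem h h'
    | smul c z _ h => rw [mul_smul_comm]; exact Submodule.smul_mem _ _ h
  | algebraMap r =>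
    intro z hz
    rw [← Algebra.smul_def]
    exact S.smul_mem _ hz
  | add y y' _ _ h h' => intro z hz; rw [add_mul]; exact add_mem (h z hz) (h' z hz)
  | mul y y' _ _ h h' => intro z hz; rw [mul_assoc]; exact h _ (h' z hz)

/-- The elements `x^a τ_w e(ν)` span. -/
theorem span_pbw_eq_top [Invertible (2 : k)] (hQ : QConds k I podd Qrep)
    (hsurj : Function.Surjective φ) (red : Equiv.Perm (Fin n) → List (Fin (n - 1)))
    (hred : ∀ w, IsReducedWord n (red w) w) :
    Submodule.span k (Set.range fun t : (Fin n → ℕ) × Equiv.Perm (Fin n) × (Fin n → I) =>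
      xMonomial φ (List.finRange n) t.1 * tauWord φ (red t.2.1) * φ (eF k I n t.2.2)) = ⊤ := by
  set S := Submodule.span k (Set.range fun t : (Fin n → ℕ) × Equiv.Perm (Fin n) × (Fin n → I) =>
      xMonomial φ (List.finRange n) t.1 * tauWord φ (red t.2.1) * φ (eF k I n t.2.2)) with hS
  have hPS : ∀ y ∈ polySubalgebra φ, ∀ w, y * tauWord φ (red w) ∈ S := by
    intro y hy w
    replace hy := mem_span_xMonomial hφ hy
    induction hy using Submodule.span_induction with
    | mem z hz =>
      obtain ⟨⟨a, ν⟩, rfl⟩ := hz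
      obtain ⟨ν', h⟩ := e_mul_tauWord hφ (red w) ν
      simp only [mul_assoc]
      rw [h, ← mul_assoc]
      exact Submodule.subset_span ⟨(a, w, ν'), rfl⟩
    | zero => simp
    | add z z' _ _ h h' => rw [add_mul]; exact add_mem h h'
    | smul c z _ h => rw [smul_mul_assoc]; exact Submodule.smul_mem _ _ h
  have hFS : ∀ m, lengthFiltration φ m ≤ S := by
    intro m
    induction m using Nat.strong_induction_on with
    | _ m ih =>
    refine Submodule.span_le.2 ?_
    rintro _ ⟨y, hy, l, hl, rfl⟩
    by_cases h : Reduced l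
    · obtain ⟨h1, h2⟩ := (hred (wordPerm l)).reduced
      obtain ⟨e, y', hy', hm⟩ := wordRel_of_reduced hφ hQ h h2 h1.symm
      have := add_mem (ih _ hl (mul_mem_lengthFiltration hy hm))
        (hPS (y * y') (mul_mem hy hy') (wordPerm l))
      rwa [mul_sub, mul_assoc, sub_add_cancel] at this
    · exact ih _ hl (mul_mem_lengthFiltration hy (tauWord_mem_of_not_reduced hφ hQ h))
  rw [eq_top_iff]
  have key : ∀ q : RFree k I n, ∀ m, ∀ z ∈ lengthFiltration φ m,
      ∃ m', φ q * z ∈ lengthFiltration φ m' := by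
    intro q
    induction q using FreeAlgebra.induction with
    | grade0 r =>
      intro m z hz
      exact ⟨m, by rw [AlgHom.commutes]; exact
        mul_mem_lengthFiltration (algebraMap_mem _ r) hz⟩
    | grade1 t =>
      intro m z hz
      cases t with
      | x p => exact ⟨m, mul_mem_lengthFiltration (x_mem φ p) hz⟩
      | tau a => exact ⟨m + 1, tau_mul_mem_lengthFiltration hφ a hz⟩
      | e ν => exact ⟨m, mul_mem_lengthFiltration (e_mem φ ν) hz⟩
    | mul a b ha hb =>
      intro m z hz
      obtain ⟨m', h⟩ := hb m z hz
      obtain ⟨m'', h'⟩ := ha m' _ h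
      exact ⟨m'', by rwa [map_mul, mul_assoc]⟩
    | add a b ha hb =>
      intro m z hz
      obtain ⟨m', h⟩ := hb m z hz
      obtain ⟨m'', h'⟩ := ha m _ hz
      exact ⟨max m' m'', by
        rw [map_add, add_mul]
        exact add_mem (lengthFiltration_mono (le_max_right _ _) h')
          (lengthFiltration_mono (le_max_left _ _) h)⟩
  intro y _
  obtain ⟨q, rfl⟩ := hsurj y
  obtain ⟨m, hm⟩ := key q 1 1 (tauWord_mem (l := []) (by simp))
  rw [mul_one] at hm
  exact hFS m hm

end Spanning

section AnticommutingElements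

variable {F M : Type*} [CommRing F] [Ring M] [Algebra F M]

lemma clifford_braid {a b c : M} (ha : a * a = 1) (hb : b * b = 1) (hc : c * c = 1)
    (hab : b * a = -(a * b)) (hbc : c * b = -(b * c)) (hac : c * a = -(a * c)) :
    (b - c) * ((a - c) * (a - b)) = (a - b) * ((a - c) * (b - c)) := by
  have hab' : ∀ y, b * (a * y) = -(a * (b * y)) := fun y => by
    rw [← mul_assoc, hab, neg_mul, mul_assoc]
  have hbc' : ∀ y, c * (b * y) = -(b * (c * y)) := fun y => by
    rw [← mul_assoc, hbc, neg_mul, mul_assoc]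
  have hac' : ∀ y, c * (a * y) = -(a * (c * y)) := fun y => by
    rw [← mul_assoc, hac, neg_mul, mul_assoc]
  have ha' : ∀ y, a * (a * y) = y := fun y => by rw [← mul_assoc, ha, one_mul]
  have hb' : ∀ y, b * (b * y) = y := fun y => by rw [← mul_assoc, hb, one_mul]
  simp only [mul_sub, sub_mul, mul_neg, neg_neg, hbc, hac, hab', hbc', hac', ha, hb, hc, ha',
    hb', mul_one]
  abel

lemma inv_mul_inv {x y z α β γ : F} (hα : α * (y - x) = 1) (hβ : β * (z - y) = 1)
    (hγ : γ * (z - x) = 1) : α * β = γ * (α + β) := by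
  linear_combination (-α * β) * hγ + γ * β * hα + γ * α * hβ

lemma inv_swap {x y α β : F} (hα : α * (y - x) = 1) (hβ : β * (x - y) = 1) : β = -α := by
  linear_combination (-β) * hα - α * hβ

section ThreeElements

variable {a b c : M} {x y z α β γ : F} (ha : a * a = x • (1 : M))
    (hb : b * b = y • (1 : M)) (hc : c * c = z • (1 : M))
    (hab : b * a = -(a * b)) (hbc : c * b = -(b * c)) (hac : c * a = -(a * c))
    (hα : α * (y - x) = 1) (hβ : β * (z - y) = 1) (hγ : γ * (z - x) = 1)

include ha hb hc hab hbc hac hα hβ hγ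

lemma anticommuting_left :
    (γ * -β) • ((c - a) * (b - c)) + (β * α) • ((c - b) * (b - a)) +
      (α * γ) • ((b - a) * (c - a)) = 0 := by
  have h := inv_mul_inv hα hβ hγ
  simp only [mul_sub, sub_mul, ha, hb, hc, hab, hbc, hac]
  match_scalars
  all_goals first
    | linear_combination h
    | linear_combination -h
    | linear_combination (-y) * h + γ * hβ - γ * hα

lemma anticommuting_right :
    (γ * -α) • ((c - a) * (a - b)) + (α * β) • ((b - a) * (c - b)) +
      (β * γ) • ((c - b) * (c - a)) = 0 := by
  have h := inv_mul_inv hα hβ hγ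
  simp only [mul_sub, sub_mul, ha, hb, hc, hab, hbc, hac]
  match_scalars
  all_goals first
    | linear_combination h
    | linear_combination -h
    | linear_combination (-y) * h + γ * hβ - γ * hα

lemma anticommuting_braid :
    (γ * (β ^ 2 * (y + z))) • (c - a) + (β * α * β) • ((c - b) * ((b - a) * (c - b))) -
      (γ * (α ^ 2 * (x + y))) • (c - a) - (α * β * α) • ((b - a) * ((c - b) * (b - a))) = 0 := by
  have h := inv_mul_inv hα hβ hγ
  have h1 : (c - b) * ((b - a) * (c - b)) = -(y + z) • (b - a) - (2 * y) • (c - b) := by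
    have e : (b - a) * (c - b) = -((c - b) * (b - a)) - (2 * y) • (1 : M) := by
      simp only [mul_sub, sub_mul, hab, hbc, hac, hb]
      module
    have e' : (c - b) * (c - b) = (y + z) • (1 : M) := by
      simp only [mul_sub, sub_mul, hbc, hb, hc]
      module
    rw [e, mul_sub, mul_neg, ← mul_assoc, e', mul_smul_comm, smul_one_mul, mul_one]
    module
  have h2 : (b - a) * ((c - b) * (b - a)) = -(x + y) • (c - b) - (2 * y) • (b - a) := by
    have e : (c - b) * (b - a) = -((b - a) * (c - b)) - (2 * y) • (1 : M) := by
      simp only [mul_sub, sub_mul, hab, hbc, hac, hb]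
      module
    have e' : (b - a) * (b - a) = (x + y) • (1 : M) := by
      simp only [mul_sub, sub_mul, hab, ha, hb]
      module
    rw [e, mul_sub, mul_neg, ← mul_assoc, e', mul_smul_comm, smul_one_mul, mul_one]
    module
  have hU : γ * (β ^ 2 * (y + z)) - 2 * y * (β * α * β) - γ * (α ^ 2 * (x + y)) +
      (x + y) * (α * β * α) = 0 := by
    linear_combination (α * (x + y) - 2 * y * β) * h + γ * β * hβ - γ * β * hα
  have hW : γ * (β ^ 2 * (y + z)) - (y + z) * (β * α * β) - γ * (α ^ 2 * (x + y)) +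
      2 * y * (α * β * α) = 0 := by
    linear_combination (2 * y * α - β * (y + z)) * h - γ * α * hβ + γ * α * hα
  rw [h1, h2]
  linear_combination (norm := module) hU • (c - b) + hW • (b - a)

end ThreeElements

end AnticommutingElements

section StrandModel

variable {I podd n}

/-- Elements `X_p`, `C_p` attached to strands `p` labelled by `μ_p ∈ I`: the `X_p` of even strands
are scalars, the `X_p` of odd strands anticommute and have scalar squares, and the `C_p` of odd
strands are Clifford generators anticommuting with the odd `X_q`.  The scalar `u p q` is the
inverse of `z q - z p`. -/
structure StrandModel (podd : I → Bool) (μ : Fin n → I) (F M : Type*) [CommRing F] [Ring M]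
    [Algebra F M] where
  z : Fin n → F
  u : Fin n → Fin n → F
  X : Fin n → M
  C : Fin n → M
  X_even : ∀ p, podd (μ p) = false → X p = z p • (1 : M)
  X_mul_self : ∀ p, podd (μ p) = true → X p * X p = z p • (1 : M)
  X_mul_X : ∀ p q, p ≠ q → podd (μ p) = true → podd (μ q) = true → X p * X q = -(X q * X p)
  C_mul_self : ∀ p, podd (μ p) = true → C p * C p = 1
  C_mul_C : ∀ p q, p ≠ q → podd (μ p) = true → podd (μ q) = true → C p * C q = -(C q * C p)
  C_mul_X : ∀ p q, podd (μ p) = true → podd (μ q) = true → C p * X q = -(X q * C p)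
  u_mul : ∀ p q, p ≠ q → μ p = μ q → u p q * (z q - z p) = 1

namespace StrandModel

variable {μ : Fin n → I} {F M : Type*} [CommRing F] [Ring M] [Algebra F M]
  (m : StrandModel podd μ F M)

/-- The scalar part of the diagonal coefficient of a crossing. -/
def r (p q : Fin n) : F := if μ p = μ q then m.u p q else 0

/-- The operator part of the diagonal coefficient of a crossing. -/
def dX (p q : Fin n) : M :=
  if podd (μ p) = true ∧ podd (μ q) = true then m.X q - m.X p else 1

/-- The operator part of the off-diagonal coefficient of a crossing. -/
def dC (p q : Fin n) : M :=
  if podd (μ p) = true ∧ podd (μ q) = true then m.C p - m.C q else 1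

/-- The diagonal coefficient of a crossing. -/
def rho (p q : Fin n) : M := m.r p q • m.dX p q

/-- The off-diagonal coefficient of a crossing, with scalar part `t`. -/
def kap (t : Fin n → Fin n → F) (p q : Fin n) : M := t p q • m.dC p q

lemma r_swap {p q : Fin n} (h : p ≠ q) : m.r q p = -m.r p q := by
  unfold r
  by_cases hpq : μ p = μ q
  · rw [if_pos hpq, if_pos hpq.symm]
    exact inv_swap (m.u_mul p q h hpq) (m.u_mul q p h.symm hpq.symm)
  · rw [if_neg hpq, if_neg (Ne.symm hpq), neg_zero]

lemma r_mul {p q : Fin n} (h : p ≠ q) (hpq : μ p = μ q) : m.r p q * (m.z q - m.z p) = 1 := by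
  rw [r, if_pos hpq]
  exact m.u_mul p q h hpq

lemma r_of_ne {p q : Fin n} (hpq : μ p ≠ μ q) : m.r p q = 0 := if_neg hpq

lemma rho_of_ne {p q : Fin n} (hpq : μ p ≠ μ q) : m.rho p q = 0 := by
  rw [rho, m.r_of_ne hpq, zero_smul]

lemma X_mul_X_comm (p q : Fin n) : m.X p * m.X q =
    if p ≠ q ∧ podd (μ p) = true ∧ podd (μ q) = true then -(m.X q * m.X p)
    else m.X q * m.X p := by
  split_ifs with h
  · exact m.X_mul_X p q h.1 h.2.1 h.2.2
  · by_cases hpq : p = q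
    · rw [hpq]
    · cases hp : podd (μ p)
      · simp [m.X_even p hp]
      · cases hq : podd (μ q)
        · simp [m.X_even q hq]
        · exact absurd ⟨hpq, hp, hq⟩ h

lemma dC_mul_X (p q s : Fin n) : m.dC p q * m.X s =
    if podd (μ s) = true ∧ podd (μ p) = true ∧ podd (μ q) = true then -(m.X s * m.dC p q)
    else m.X s * m.dC p q := by
  cases hs : podd (μ s)
  · simp [m.X_even s hs]
  · by_cases h : podd (μ p) = true ∧ podd (μ q) = true
    · simp only [dC, h, if_true, and_self, sub_mul, mul_sub, m.C_mul_X p s h.1 hs,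
        m.C_mul_X q s h.2 hs]
      abel
    · simp [dC, h]

lemma dC_mul_dX (p q s t : Fin n) : m.dC p q * m.dX s t =
    if podd (μ p) = true ∧ podd (μ q) = true ∧ podd (μ s) = true ∧ podd (μ t) = true then
      -(m.dX s t * m.dC p q)
    else m.dX s t * m.dC p q := by
  by_cases h : podd (μ s) = true ∧ podd (μ t) = true
  · simp only [dX, h, if_true, and_self, and_true, mul_sub, sub_mul, m.dC_mul_X, true_and]
    split_ifs <;> abel
  · rw [if_neg (fun h' => h h'.2.2)]
    simp [dX, h]

lemma kap_mul_X (t : Fin n → Fin n → F) (p q s : Fin n) : m.kap t p q * m.X s =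
    if podd (μ s) = true ∧ podd (μ p) = true ∧ podd (μ q) = true then -(m.X s * m.kap t p q)
    else m.X s * m.kap t p q := by
  simp only [kap, smul_mul_assoc, mul_smul_comm, m.dC_mul_X]
  split_ifs <;> simp

lemma dX_mul_X {p q s : Fin n} (hp : s ≠ p) (hq : s ≠ q) : m.dX p q * m.X s =
    if podd (μ s) = true ∧ podd (μ p) = true ∧ podd (μ q) = true then -(m.X s * m.dX p q)
    else m.X s * m.dX p q := by
  by_cases h : podd (μ p) = true ∧ podd (μ q) = true
  · simp only [dX, h, if_true, and_self, and_true, mul_sub, sub_mul, m.X_mul_X_comm _ s,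
      hp.symm, hq.symm, ne_eq, not_false_eq_true, true_and]
    split_ifs <;> abel
  · simp [dX, h]

lemma rho_mul_X {p q s : Fin n} (hp : s ≠ p) (hq : s ≠ q) : m.rho p q * m.X s =
    if podd (μ s) = true ∧ podd (μ p) = true ∧ podd (μ q) = true then -(m.X s * m.rho p q)
    else m.X s * m.rho p q := by
  simp only [rho, smul_mul_assoc, mul_smul_comm, m.dX_mul_X hp hq]
  split_ifs <;> simp

lemma dX_mul_dX {p q s t : Fin n} (h1 : s ≠ p) (h2 : s ≠ q) (h3 : t ≠ p) (h4 : t ≠ q) :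
    m.dX p q * m.dX s t =
    if podd (μ p) = true ∧ podd (μ q) = true ∧ podd (μ s) = true ∧ podd (μ t) = true then
      -(m.dX s t * m.dX p q)
    else m.dX s t * m.dX p q := by
  by_cases h : podd (μ s) = true ∧ podd (μ t) = true
  · simp only [dX.eq_1 m s t, h, if_true, and_self, and_true, mul_sub, sub_mul, m.dX_mul_X h1 h2,
      m.dX_mul_X h3 h4, true_and]
    split_ifs <;> abel
  · rw [if_neg (fun h' => h h'.2.2)]
    simp [dX.eq_1 m s t, h]

lemma dC_mul_dC {p q s t : Fin n} (h1 : s ≠ p) (h2 : s ≠ q) (h3 : t ≠ p) (h4 : t ≠ q) :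
    m.dC p q * m.dC s t =
    if podd (μ p) = true ∧ podd (μ q) = true ∧ podd (μ s) = true ∧ podd (μ t) = true then
      -(m.dC s t * m.dC p q)
    else m.dC s t * m.dC p q := by
  by_cases h : podd (μ p) = true ∧ podd (μ q) = true
  · by_cases h' : podd (μ s) = true ∧ podd (μ t) = true
    · simp only [dC, h, h', if_true, and_self, mul_sub, sub_mul, m.C_mul_C p s h1.symm h.1 h'.1,
        m.C_mul_C q s h2.symm h.2 h'.1, m.C_mul_C p t h3.symm h.1 h'.2,
        m.C_mul_C q t h4.symm h.2 h'.2]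
      abel
    · rw [if_neg (fun h'' => h' h''.2.2)]
      simp [dC, h']
  · rw [if_neg (fun h' => h ⟨h'.1, h'.2.1⟩)]
    simp [dC, h]

lemma dC_mul_swap {p q : Fin n} (h : p ≠ q) : m.dC p q * m.dC q p =
    (if podd (μ p) = true ∧ podd (μ q) = true then (-2 : F) else 1) • (1 : M) := by
  by_cases h' : podd (μ p) = true ∧ podd (μ q) = true
  · simp only [dC, h', if_true, and_self, mul_sub, sub_mul, m.C_mul_self p h'.1,
      m.C_mul_self q h'.2, m.C_mul_C p q h h'.1 h'.2]
    module
  · simp [dC, h', and_comm]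

lemma dC_braid {p q s : Fin n} (hpq : p ≠ q) (hqs : q ≠ s) (hps : p ≠ s) :
    m.dC q s * (m.dC p s * m.dC p q) = m.dC p q * (m.dC p s * m.dC q s) := by
  cases hp : podd (μ p) <;> cases hq : podd (μ q) <;> cases hs : podd (μ s) <;>
    simp only [dC, hp, hq, hs, mul_one, one_mul, reduceCtorEq, and_self, and_true,
      and_false, if_true, if_false]
  exact clifford_braid (m.C_mul_self p hp) (m.C_mul_self q hq) (m.C_mul_self s hs)
    (m.C_mul_C q p hpq.symm hq hp) (m.C_mul_C s q hqs.symm hs hq)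
    (m.C_mul_C s p hps.symm hs hp)

lemma dX_mul_self (p q : Fin n) (h : p ≠ q) : m.dX p q * m.dX p q =
    (if podd (μ p) = true ∧ podd (μ q) = true then m.z p + m.z q else 1) • (1 : M) := by
  by_cases h' : podd (μ p) = true ∧ podd (μ q) = true
  · simp only [dX, h', if_true, and_self, mul_sub, sub_mul, m.X_mul_self p h'.1,
      m.X_mul_self q h'.2, m.X_mul_X p q h h'.1 h'.2]
    module
  · simp [dX, h']

end StrandModel

end StrandModel

section CrossingIdentities

variable {I podd n}

namespace StrandModel

variable {μ : Fin n → I} {F M : Type*} [CommRing F] [Ring M] [Algebra F M]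
  (m : StrandModel podd μ F M)

lemma dX_of_odd {p q : Fin n} (hp : podd (μ p) = true) (hq : podd (μ q) = true) :
    m.dX p q = m.X q - m.X p := if_pos ⟨hp, hq⟩

lemma dX_of_even {p q : Fin n} (hp : podd (μ p) = false) : m.dX p q = 1 := by simp [dX, hp]

lemma dC_of_even_left {p q : Fin n} (hp : podd (μ p) = false) : m.dC p q = 1 := by simp [dC, hp]

lemma rho_mul_X_sub {p q : Fin n} (h : p ≠ q) (hpq : μ p = μ q) :
    m.rho p q * m.X q
      - (if podd (μ p) = true ∧ podd (μ q) = true then -(m.X p * m.rho p q)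
        else m.X p * m.rho p q) = 1 := by
  have hr := m.r_mul h hpq
  cases hp : podd (μ p)
  · have hq : podd (μ q) = false := hpq ▸ hp
    simp only [rho, m.dX_of_even hp, m.X_even p hp, m.X_even q hq, reduceCtorEq, false_and,
      if_false, smul_mul_smul_comm, mul_one]
    linear_combination (norm := module) hr • (1 : M)
  · have hq : podd (μ q) = true := hpq ▸ hp
    simp only [rho, m.dX_of_odd hp hq, hq, and_self, if_true, smul_mul_assoc, mul_smul_comm, mul_sub,
      sub_mul, m.X_mul_self p hp, m.X_mul_self q hq]
    linear_combination (norm := module) hr • (1 : M)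

lemma X_mul_rho_sub {p q : Fin n} (h : p ≠ q) (hpq : μ p = μ q) :
    m.X q * m.rho p q
      - (if podd (μ p) = true ∧ podd (μ q) = true then -(m.rho p q * m.X p)
        else m.rho p q * m.X p) = 1 := by
  have hr := m.r_mul h hpq
  cases hp : podd (μ p)
  · have hq : podd (μ q) = false := hpq ▸ hp
    simp only [rho, m.dX_of_even hp, m.X_even p hp, m.X_even q hq, reduceCtorEq, false_and,
      if_false, smul_mul_smul_comm, mul_one]
    linear_combination (norm := module) hr • (1 : M)
  · have hq : podd (μ q) = true := hpq ▸ hp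
    simp only [rho, m.dX_of_odd hp hq, hq, and_self, if_true, smul_mul_assoc, mul_smul_comm, mul_sub,
      sub_mul, m.X_mul_self p hp, m.X_mul_self q hq]
    linear_combination (norm := module) hr • (1 : M)

variable (t : Fin n → Fin n → F)

lemma kap_mul_rho_swap {p q : Fin n} (h : p ≠ q) :
    m.kap t p q * m.rho q p + m.rho p q * m.kap t p q = 0 := by
  by_cases hpq : μ p = μ q
  · cases hp : podd (μ p)
    · have hq : podd (μ q) = false := hpq ▸ hp
      simp only [kap, rho, m.dC_of_even_left hp, m.dX_of_even hp, m.dX_of_even hq, m.r_swap h]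
      simp only [smul_mul_smul_comm, mul_one]
      module
    · have hq : podd (μ q) = true := hpq ▸ hp
      simp only [kap, rho, m.dX_of_odd hp hq, m.dX_of_odd hq hp, m.r_swap h, smul_mul_assoc,
        mul_smul_comm, mul_sub, sub_mul, m.dC_mul_X, hp, hq, and_self, if_true]
      module
  · rw [m.rho_of_ne hpq, m.rho_of_ne (Ne.symm hpq), mul_zero, zero_mul, add_zero]

/-- The quadratic condition on the scalar parts of the off-diagonal crossing coefficients. -/
def Compatible (t Qs : Fin n → Fin n → F) : Prop :=
  ∀ p q, p ≠ q → t p q * t q p * (if podd (μ p) = true ∧ podd (μ q) = true then -2 else 1) =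
    Qs p q - m.r p q ^ 2 *
      (if podd (μ p) = true ∧ podd (μ q) = true then m.z p + m.z q else 1)

variable {t} {Qs : Fin n → Fin n → F}

lemma kap_mul_kap_swap (ht : m.Compatible t Qs) {p q : Fin n} (h : p ≠ q) :
    m.kap t p q * m.kap t q p + m.rho p q * m.rho p q = Qs p q • (1 : M) := by
  have h1 := ht p q h
  simp only [kap, rho, smul_mul_smul_comm, m.dC_mul_swap h, m.dX_mul_self p q h]
  linear_combination (norm := module) h1 • (1 : M)

variable (t)

lemma kap_braid {p q s : Fin n} (hpq : p ≠ q) (hqs : q ≠ s) (hps : p ≠ s) :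
    m.kap t q s * (m.kap t p s * m.kap t p q) = m.kap t p q * (m.kap t p s * m.kap t q s) := by
  simp only [kap, smul_mul_smul_comm, m.dC_braid hpq hqs hps]
  congr 1
  ring

lemma kap_kap_rho (p q s : Fin n) :
    m.kap t q s * (m.kap t p s * m.rho p q) = m.rho p q * (m.kap t q s * m.kap t p s) := by
  by_cases hpq : μ p = μ q
  · have key : m.dC q s * (m.dC p s * m.dX p q) = m.dX p q * (m.dC q s * m.dC p s) := by
      have hq : podd (μ q) = podd (μ p) := by rw [hpq]
      rw [m.dC_mul_dX p s, mul_ite, mul_neg, ← mul_assoc (m.dC q s), m.dC_mul_dX q s, hq]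
      split_ifs <;> first | (exfalso; tauto) | simp [mul_assoc]
    simp only [kap, rho, smul_mul_smul_comm, key]
    congr 1
    ring
  · simp [m.rho_of_ne hpq]

lemma rho_kap_kap (p q s : Fin n) :
    m.rho q s * (m.kap t p q * m.kap t p s) = m.kap t p q * (m.kap t p s * m.rho q s) := by
  by_cases hqs : μ q = μ s
  · have key : m.dC p q * (m.dC p s * m.dX q s) = m.dX q s * (m.dC p q * m.dC p s) := by
      have hq : podd (μ q) = podd (μ s) := by rw [hqs]
      rw [m.dC_mul_dX p s, mul_ite, mul_neg, ← mul_assoc (m.dC p q), m.dC_mul_dX p q, hq]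
      split_ifs <;> first | (exfalso; tauto) | simp [mul_assoc]
    simp only [kap, rho, smul_mul_smul_comm, key]
    congr 1
    ring
  · simp [m.rho_of_ne hqs]

lemma kap_rho_rho_left {p q s : Fin n} (hpq : p ≠ q) (hqs : q ≠ s) (hps : p ≠ s) :
    m.kap t q s * (m.rho p s * m.rho s q) + m.rho q s * (m.rho p q * m.kap t q s) =
      m.rho p q * (m.kap t q s * m.rho p s) := by
  by_cases h1 : μ p = μ q
  · by_cases h2 : μ q = μ s
    · have hα := m.r_mul hpq h1
      have hβ := m.r_mul hqs h2
      have hγ := m.r_mul hps (h1.trans h2)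
      cases hp : podd (μ p)
      · have hq : podd (μ q) = false := h1 ▸ hp
        have hs : podd (μ s) = false := h2 ▸ hq
        have key := inv_mul_inv hα hβ hγ
        simp only [kap, rho, m.dX_of_even hp, m.dX_of_even hq, m.dX_of_even hs,
          m.dC_of_even_left hq, m.r_swap hqs, smul_mul_smul_comm, mul_one]
        linear_combination (norm := module) (t q s * key) • (1 : M)
      · have hq : podd (μ q) = true := h1 ▸ hp
        have hs : podd (μ s) = true := h2 ▸ hq
        have key := anticommuting_left (m.X_mul_self p hp) (m.X_mul_self q hq)
          (m.X_mul_self s hs) (m.X_mul_X q p hpq.symm hq hp) (m.X_mul_X s q hqs.symm hs hq)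
          (m.X_mul_X s p hps.symm hs hp) hα hβ hγ
        have c1 : m.dC q s * (m.dX p s * m.dX s q) = m.dX p s * m.dX s q * m.dC q s := by
          rw [← mul_assoc, m.dC_mul_dX]
          simp only [hq, hs, hp, and_self, if_true, neg_mul, mul_assoc]
          rw [m.dC_mul_dX]
          simp [hq, hs]
        have c2 : m.dX p q * (m.dC q s * m.dX p s) = -(m.dX p q * m.dX p s * m.dC q s) := by
          rw [m.dC_mul_dX]
          simp [hp, hq, hs, mul_assoc]
        simp only [kap, rho, smul_mul_smul_comm, c1, c2, m.r_swap hqs]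
        rw [← mul_assoc (m.dX q s)]
        have key' := congrArg (fun v => t q s • (v * m.dC q s)) key
        simp only [m.dX_of_odd, hp, hq, hs]
        simp only [add_mul, smul_mul_assoc, zero_mul, smul_zero, smul_add] at key'
        linear_combination (norm := module) key'
    · have h3 : μ p ≠ μ s := fun h => h2 (h1.symm.trans h)
      simp [m.rho_of_ne h2, m.rho_of_ne h3]
  · rw [m.rho_of_ne h1]
    by_cases h2 : μ p = μ s
    · have h3 : μ s ≠ μ q := fun h => h1 (h2.trans h)
      simp [m.rho_of_ne h3]
    · simp [m.rho_of_ne h2]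

lemma kap_rho_rho_right {p q s : Fin n} (hpq : p ≠ q) (hqs : q ≠ s) (hps : p ≠ s) :
    m.rho q s * (m.kap t p q * m.rho p s) =
      m.kap t p q * (m.rho p s * m.rho q p) + m.rho p q * (m.rho q s * m.kap t p q) := by
  by_cases h1 : μ p = μ q
  · by_cases h2 : μ q = μ s
    · have hα := m.r_mul hpq h1
      have hβ := m.r_mul hqs h2
      have hγ := m.r_mul hps (h1.trans h2)
      cases hp : podd (μ p)
      · have hq : podd (μ q) = false := h1 ▸ hp
        have key := inv_mul_inv hα hβ hγ
        simp only [kap, rho, m.dX_of_even hp, m.dX_of_even hq,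
          m.dC_of_even_left hp, m.r_swap hpq, smul_mul_smul_comm, mul_one]
        linear_combination (norm := module) -(t p q * key) • (1 : M)
      · have hq : podd (μ q) = true := h1 ▸ hp
        have hs : podd (μ s) = true := h2 ▸ hq
        have key := anticommuting_right (m.X_mul_self p hp) (m.X_mul_self q hq)
          (m.X_mul_self s hs) (m.X_mul_X q p hpq.symm hq hp) (m.X_mul_X s q hqs.symm hs hq)
          (m.X_mul_X s p hps.symm hs hp) hα hβ hγ
        have c1 : m.dC p q * (m.dX p s * m.dX q p) = m.dX p s * m.dX q p * m.dC p q := by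
          rw [← mul_assoc, m.dC_mul_dX]
          simp only [hq, hs, hp, and_self, if_true, neg_mul, mul_assoc]
          rw [m.dC_mul_dX]
          simp [hq, hp]
        have c2 : m.dX q s * (m.dC p q * m.dX p s) = -(m.dX q s * m.dX p s * m.dC p q) := by
          rw [m.dC_mul_dX]
          simp [hp, hq, hs, mul_assoc]
        simp only [kap, rho, smul_mul_smul_comm, c1, c2, m.r_swap hpq]
        rw [← mul_assoc (m.dX p q)]
        have key' := congrArg (fun v => t p q • (v * m.dC p q)) key
        simp only [m.dX_of_odd, hp, hq, hs]
        simp only [add_mul, smul_mul_assoc, zero_mul, smul_zero, smul_add] at key'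
        linear_combination (norm := module) -key'
    · have h3 : μ p ≠ μ s := fun h => h2 (h1.symm.trans h)
      simp [m.rho_of_ne h2, m.rho_of_ne h3]
  · rw [m.rho_of_ne h1, m.rho_of_ne (Ne.symm h1)]
    by_cases h2 : μ p = μ s
    · have h3 : μ q ≠ μ s := fun h => h1 (h2.trans h.symm)
      simp [m.rho_of_ne h3]
    · simp [m.rho_of_ne h2]

variable {t}

lemma kap_rho_kap_left (ht : m.Compatible t Qs) {p q s : Fin n} (hqs : q ≠ s)
    (h : μ p = μ s) : m.kap t q s * (m.rho p s * m.kap t s q) =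
      ((if podd (μ p) = true ∧ podd (μ q) = true then -1 else 1) * m.r p s *
        (Qs q s - m.r q s ^ 2 *
          (if podd (μ q) = true ∧ podd (μ s) = true then m.z q + m.z s else 1))) • m.dX p s := by
  have key : m.dC q s * (m.dX p s * m.dC s q) =
      ((if podd (μ p) = true ∧ podd (μ q) = true then -1 else 1) *
        (if podd (μ q) = true ∧ podd (μ s) = true then (-2 : F) else 1)) • m.dX p s := by
    rw [← mul_assoc, m.dC_mul_dX, ite_mul, neg_mul, mul_assoc, m.dC_mul_swap hqs, h]
    cases hs : podd (μ s) <;> cases hq : podd (μ q) <;> simp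
  simp only [kap, rho, smul_mul_smul_comm, key, ← ht q s hqs, smul_smul]
  congr 1
  ring

lemma kap_rho_kap_right (ht : m.Compatible t Qs) {p q s : Fin n} (hpq : p ≠ q)
    (h : μ p = μ s) : m.kap t p q * (m.rho p s * m.kap t q p) =
      ((if podd (μ p) = true ∧ podd (μ q) = true then -1 else 1) * m.r p s *
        (Qs p q - m.r p q ^ 2 *
          (if podd (μ p) = true ∧ podd (μ q) = true then m.z p + m.z q else 1))) • m.dX p s := by
  have key : m.dC p q * (m.dX p s * m.dC q p) =
      ((if podd (μ p) = true ∧ podd (μ q) = true then -1 else 1) *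
        (if podd (μ p) = true ∧ podd (μ q) = true then (-2 : F) else 1)) • m.dX p s := by
    rw [← mul_assoc, m.dC_mul_dX, ite_mul, neg_mul, mul_assoc, m.dC_mul_swap hpq, h]
    cases hs : podd (μ s) <;> cases hq : podd (μ q) <;> simp
  simp only [kap, rho, smul_mul_smul_comm, key, ← ht p q hpq, smul_smul]
  congr 1
  ring

lemma braid_defect (ht : m.Compatible t Qs) (hdiag : ∀ p q, μ p = μ q → p ≠ q → Qs p q = 0)
    {p q s : Fin n} (hpq : p ≠ q) (hqs : q ≠ s) (hps : p ≠ s) :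
    m.kap t q s * (m.rho p s * m.kap t s q) + m.rho q s * (m.rho p q * m.rho q s)
      - m.kap t p q * (m.rho p s * m.kap t q p) - m.rho p q * (m.rho q s * m.rho p q) =
    ((if podd (μ p) = true ∧ podd (μ q) = true then -1 else 1) * m.r p s *
      (Qs q s - Qs p q)) • m.dX p s := by
  by_cases h : μ p = μ s
  · rw [m.kap_rho_kap_left ht hqs h, m.kap_rho_kap_right ht hpq h]
    by_cases h1 : μ p = μ q
    · have h2 : μ q = μ s := h1.symm.trans h
      have hα := m.r_mul hpq h1
      have hβ := m.r_mul hqs h2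
      have hγ := m.r_mul hps (h1.trans h2)
      rw [hdiag q s h2 hqs, hdiag p q h1 hpq]
      cases hp : podd (μ p)
      · have hq : podd (μ q) = false := h1 ▸ hp
        have key := inv_mul_inv hα hβ hγ
        simp only [rho, m.dX_of_even hp, m.dX_of_even hq, smul_mul_smul_comm, mul_one,
          hq, reduceCtorEq, false_and, if_false]
        linear_combination (norm := module) ((m.r q s - m.r p q) * key) • (1 : M)
      · have hq : podd (μ q) = true := h1 ▸ hp
        have hs : podd (μ s) = true := h2 ▸ hq
        have key := anticommuting_braid (m.X_mul_self p hp) (m.X_mul_self q hq)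
          (m.X_mul_self s hs) (m.X_mul_X q p hpq.symm hq hp) (m.X_mul_X s q hqs.symm hs hq)
          (m.X_mul_X s p hps.symm hs hp) hα hβ hγ
        simp only [rho, m.dX_of_odd, hp, hq, hs, smul_mul_smul_comm, and_self, if_true]
        linear_combination (norm := module) key
    · have h2 : μ q ≠ μ s := fun h' => h1 (h.trans h'.symm)
      rw [m.rho_of_ne h1, m.rho_of_ne h2, m.r_of_ne h1, m.r_of_ne h2]
      simp only [mul_zero]
      module
  · rw [m.rho_of_ne h, m.r_of_ne h]
    by_cases h1 : μ p = μ q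
    · have h2 : μ q ≠ μ s := fun h' => h (h1.trans h')
      simp [m.rho_of_ne h2]
    · simp [m.rho_of_ne h1]

end StrandModel

end CrossingIdentities

section EvaluationAtStrands

variable {I podd n}
variable {F M : Type*} [CommRing F] [Ring M] [Algebra F M] [Algebra k F] [Algebra k M]
  [IsScalarTower k F M]

/-- Evaluation `f(w, z) ↦ f(X, Y)` of a noncommutative polynomial. -/
noncomputable def evalPair (X Y : M) : FreeAlgebra k (Fin 2) →ₐ[k] M :=
  FreeAlgebra.lift k fun t : Fin 2 => if t = 0 then X else Y

@[simp] lemma evalPair_zero (X Y : M) : evalPair k X Y (FreeAlgebra.ι k 0) = X := by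
  simp [evalPair]

@[simp] lemma evalPair_one (X Y : M) : evalPair k X Y (FreeAlgebra.ι k 1) = Y := by
  simp [evalPair]

lemma evalPair_negW (X Y : M) (f : FreeAlgebra k (Fin 2)) :
    evalPair k X Y (negW k f) = evalPair k (-X) Y f := by
  have : (evalPair k X Y).comp (negW k) = evalPair k (-X) Y := by
    ext t
    fin_cases t <;> simp
  exact DFunLike.congr_fun this f

lemma evalPair_swapWZ (X Y : M) (f : FreeAlgebra k (Fin 2)) :
    evalPair k X Y (swapWZ k f) = evalPair k Y X f := by
  have : (evalPair k X Y).comp (swapWZ k) = evalPair k Y X := by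
    ext t
    fin_cases t <;> simp
  exact DFunLike.congr_fun this f

/-- If `X²`, `Y²` are scalars and `X`, `Y` commute up to a scalar, then `f(X, Y)` is a combination
of `1`, `X`, `Y`, `XY` with coefficients depending only on these scalars. -/
lemma exists_evalPair_eq (x y σ : F) (f : FreeAlgebra k (Fin 2)) :
    ∃ a b c d : F, ∀ X Y : M, X * X = x • (1 : M) → Y * Y = y • (1 : M) →
      Y * X = σ • (X * Y) →
      evalPair k X Y f = a • (1 : M) + b • X + c • Y + d • (X * Y) := by
  induction f using FreeAlgebra.induction with
  | grade0 r =>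
    refine ⟨algebraMap k F r, 0, 0, 0, fun X Y _ _ _ => ?_⟩
    rw [AlgHom.commutes, algebraMap_smul, Algebra.algebraMap_eq_smul_one]
    simp
  | grade1 t =>
    fin_cases t
    · exact ⟨0, 1, 0, 0, fun X Y _ _ _ => by simp⟩
    · exact ⟨0, 0, 1, 0, fun X Y _ _ _ => by simp⟩
  | add f g hf hg =>
    obtain ⟨a, b, c, d, hf⟩ := hf
    obtain ⟨a', b', c', d', hg⟩ := hg
    refine ⟨a + a', b + b', c + c', d + d', fun X Y hX hY h => ?_⟩
    rw [map_add, hf X Y hX hY h, hg X Y hX hY h]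
    module
  | mul f g hf hg =>
    obtain ⟨a, b, c, d, hf⟩ := hf
    obtain ⟨a', b', c', d', hg⟩ := hg
    refine ⟨a * a' + b * b' * x + c * c' * y + d * d' * σ * x * y,
      a * b' + b * a' + c * d' * σ * y + d * c' * y,
      a * c' + c * a' + b * d' * x + d * b' * σ * x,
      a * d' + d * a' + b * c' + c * b' * σ, fun X Y hX hY h => ?_⟩
    rw [map_mul, hf X Y hX hY h, hg X Y hX hY h]
    have e1 : X * (X * Y) = x • Y := by rw [← mul_assoc, hX, smul_mul_assoc, one_mul]
    have e2 : Y * (X * Y) = (σ * y) • X := by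
      rw [← mul_assoc, h, smul_mul_assoc, mul_assoc, hY, mul_smul_comm, mul_one, smul_smul]
    simp only [add_mul, mul_add, smul_mul_assoc, mul_smul_comm, one_mul, mul_one, hX, hY, h,
      mul_assoc, e1, e2]
    module

lemma eq_zero_of_two_smul [Invertible (2 : k)] {v : M} (h : v + v = 0) : v = 0 := by
  have h2 : (2 : k) • v = 0 := by rw [two_smul, h]
  rw [← one_smul k v, ← invOf_mul_self (2 : k), mul_smul, h2, smul_zero]

namespace StrandModel

variable {μ : Fin n → I} (m : StrandModel podd μ F M)
variable {k} {Qrep : I → I → FreeAlgebra k (Fin 2)} (hQ : QConds k I podd Qrep)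

lemma exists_X_mul_self (p : Fin n) : ∃ x : F, m.X p * m.X p = x • (1 : M) := by
  cases hp : podd (μ p)
  · exact ⟨m.z p * m.z p, by simp [m.X_even p hp, smul_smul]⟩
  · exact ⟨m.z p, m.X_mul_self p hp⟩

include hQ

lemma evalPair_symm {i j : I} {X Y : M} (h : Y * X = if podd i ∧ podd j then -(X * Y) else X * Y) :
    evalPair k Y X (Qrep j i) = evalPair k X Y (Qrep i j) := by
  rw [← evalPair_swapWZ]
  exact eq_of_mkA2_eq (evalPair k X Y) (by simpa using h) (hQ.symm i j)

lemma evalPair_neg_left {i j : I} (hi : podd i = true) {X Y : M}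
    (h : Y * X = if podd i ∧ podd j then -(X * Y) else X * Y) :
    evalPair k (-X) Y (Qrep i j) = evalPair k X Y (Qrep i j) := by
  rw [← evalPair_negW]
  exact eq_of_mkA2_eq (evalPair k X Y) (by simpa using h) (hQ.even i j hi)

lemma evalPair_neg_right {i j : I} (hj : podd j = true) {X Y : M}
    (h : Y * X = if podd i ∧ podd j then -(X * Y) else X * Y) :
    evalPair k X (-Y) (Qrep i j) = evalPair k X Y (Qrep i j) := by
  have h' : X * Y = if podd j ∧ podd i then -(Y * X) else Y * X := by
    rw [h]; split_ifs <;> first | (exfalso; tauto) | simp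
  rw [← evalPair_symm hQ (X := X) (Y := -Y) (by rw [neg_mul, mul_neg, h]; split_ifs <;> simp),
    evalPair_neg_left hQ hj h', evalPair_symm hQ h]

lemma exists_evalPair_scalar [Invertible (2 : k)] {p q : Fin n} (hpq : p ≠ q) :
    ∃ s : F, evalPair k (m.X p) (m.X q) (Qrep (μ p) (μ q)) = s • (1 : M) := by
  obtain ⟨x, hx⟩ := m.exists_X_mul_self p
  obtain ⟨y, hy⟩ := m.exists_X_mul_self q
  have hcomm : m.X q * m.X p =
      if podd (μ p) ∧ podd (μ q) then -(m.X p * m.X q) else m.X p * m.X q := by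
    rw [m.X_mul_X_comm q p]
    split_ifs <;> first | rfl | (exfalso; tauto)
  have hσ : m.X q * m.X p =
      (if podd (μ p) ∧ podd (μ q) then (-1 : F) else 1) • (m.X p * m.X q) := by
    rw [hcomm]; split_ifs <;> simp
  obtain ⟨a, b, c, d, h⟩ := exists_evalPair_eq (M := M) k x y
    (if podd (μ p) ∧ podd (μ q) then (-1 : F) else 1) (Qrep (μ p) (μ q))
  have h0 := h _ _ hx hy hσ
  have hl : podd (μ p) = true → b • m.X p + d • (m.X p * m.X q) = 0 := fun hp => by
    have h1 := h (-m.X p) (m.X q) (by simpa using hx) hy (by simpa using hσ)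
    rw [evalPair_neg_left hQ hp hcomm, h0] at h1
    refine eq_zero_of_two_smul k ?_
    rw [neg_mul] at h1
    linear_combination (norm := module) h1
  have hr : podd (μ q) = true → c • m.X q + d • (m.X p * m.X q) = 0 := fun hq => by
    have h1 := h (m.X p) (-m.X q) hx (by simpa using hy) (by simpa using hσ)
    rw [evalPair_neg_right hQ hq hcomm, h0] at h1
    refine eq_zero_of_two_smul k ?_
    rw [mul_neg] at h1
    linear_combination (norm := module) h1
  rw [h0]
  cases hp : podd (μ p) <;> cases hq : podd (μ q)
  · rw [m.X_even p hp, m.X_even q hq]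
    refine ⟨a + b * m.z p + c * m.z q + d * (m.z p * m.z q), ?_⟩
    rw [smul_mul_smul_comm, mul_one]
    module
  · refine ⟨a + b * m.z p, ?_⟩
    have := hr hq
    rw [m.X_even p hp] at this ⊢
    linear_combination (norm := module) this
  · refine ⟨a + c * m.z q, ?_⟩
    have := hl hp
    rw [m.X_even q hq] at this ⊢
    linear_combination (norm := module) this
  · have h1 := hl hp
    have h2 := hr hq
    have h3 := h (-m.X p) (-m.X q) (by simpa using hx) (by simpa using hy) (by simpa using hσ)
    have hc2 : -m.X q * m.X p =
      if podd (μ p) ∧ podd (μ q) then -(m.X p * -m.X q) else m.X p * -m.X q := by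
      rw [neg_mul, hcomm]; split_ifs <;> simp
    rw [evalPair_neg_left hQ hp hc2, evalPair_neg_right hQ hq hcomm, h0] at h3
    refine ⟨a, ?_⟩
    have h4 : b • m.X p + c • m.X q = 0 := by
      refine eq_zero_of_two_smul k ?_
      rw [neg_mul_neg] at h3
      linear_combination (norm := module) h3
    have h5 : d • (m.X p * m.X q) = 0 := by
      refine eq_zero_of_two_smul k ?_
      linear_combination (norm := module) h1 + h2 - h4
    linear_combination (norm := module) h4 + h5

/-- The scalars through which `Q_{μ_p,μ_q}(X_p, X_q)` acts can be chosen symmetrically. -/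
lemma exists_symmetric_scalars [Invertible (2 : k)] : ∃ Qs : Fin n → Fin n → F,
    (∀ p q, Qs p q = Qs q p) ∧ (∀ p q, p ≠ q → μ p = μ q → Qs p q = 0) ∧
    ∀ p q, p ≠ q → evalPair k (m.X p) (m.X q) (Qrep (μ p) (μ q)) = Qs p q • (1 : M) := by
  have hcomm : ∀ p q, p ≠ q → m.X q * m.X p =
      if podd (μ p) ∧ podd (μ q) then -(m.X p * m.X q) else m.X p * m.X q := fun p q hpq => by
    rw [m.X_mul_X_comm q p]
    split_ifs <;> first | rfl | (exfalso; tauto)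
  choose s hs using fun (p q : Fin n) (h : p ≠ q) => m.exists_evalPair_scalar hQ h
  refine ⟨fun p q => if h : μ p ≠ μ q then
    (if p < q then s p q (fun e => h (congrArg μ e)) else s q p (fun e => h (congrArg μ e.symm)))
    else 0, ?_, ?_, ?_⟩
  · intro p q
    by_cases h : μ p = μ q
    · simp [h]
    · have hpq : p ≠ q := fun e => h (congrArg μ e)
      beta_reduce
      rw [dif_pos h, dif_pos (Ne.symm h)]
      rcases lt_or_gt_of_ne hpq with h' | h'
      · rw [if_pos h', if_neg h'.not_gt]
      · rw [if_neg h'.not_gt, if_pos h']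
  · intro p q _ h
    simp [h]
  · intro p q hpq
    by_cases h : μ p = μ q
    · simp only [h, ne_eq, not_true_eq_false, dite_false, zero_smul]
      have := eq_of_mkA2_eq (podd := podd) (i := μ q) (j := μ q) (evalPair k (m.X p) (m.X q))
        (by simpa [h] using hcomm p q hpq) ((hQ.diag (μ q)).trans (map_zero _).symm)
      rw [this, map_zero]
    · beta_reduce
      rw [dif_pos h]
      split_ifs with h'
      · exact hs p q hpq
      · rw [← evalPair_symm hQ (hcomm p q hpq)]
        exact hs q p hpq.symm

omit hQ

lemma exists_compatible [Invertible (2 : k)] {Qs : Fin n → Fin n → F}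
    (hsymm : ∀ p q, Qs p q = Qs q p) :
    ∃ t : Fin n → Fin n → F, (∀ p q, q < p → t p q = 1) ∧ m.Compatible t Qs := by
  have h2 : algebraMap k F ⅟2 * 2 = 1 := by
    rw [← map_ofNat (algebraMap k F) 2, ← map_mul, invOf_mul_self, map_one]
  have key : ∀ p q, p ≠ q → Qs q p - m.r q p ^ 2 *
      (if podd (μ q) = true ∧ podd (μ p) = true then m.z q + m.z p else 1) =
      Qs p q - m.r p q ^ 2 *
      (if podd (μ p) = true ∧ podd (μ q) = true then m.z p + m.z q else 1) := fun p q h => by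
    simp only [hsymm q p, m.r_swap h, neg_sq, add_comm (m.z q), and_comm]
  refine ⟨fun p q => if q < p then 1 else
    (if podd (μ p) = true ∧ podd (μ q) = true then -algebraMap k F ⅟2 else 1) *
    (Qs p q - m.r p q ^ 2 *
      (if podd (μ p) = true ∧ podd (μ q) = true then m.z p + m.z q else 1)),
    fun p q h => if_pos h, fun p q hpq => ?_⟩
  have aux : (if podd (μ p) = true ∧ podd (μ q) = true then -algebraMap k F ⅟2 else 1) *
      (if podd (μ p) = true ∧ podd (μ q) = true then (-2 : F) else 1) = 1 := by
    split_ifs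
    · linear_combination h2
    · ring
  rcases lt_or_gt_of_ne hpq with h | h
  · simp only [if_pos h, if_neg h.not_gt]
    linear_combination aux * (Qs p q - m.r p q ^ 2 *
      (if podd (μ p) = true ∧ podd (μ q) = true then m.z p + m.z q else 1))
  · simp only [if_pos h, if_neg h.not_gt, key p q hpq]
    simp only [and_comm (a := podd (μ q) = true)]
    linear_combination aux * (Qs p q - m.r p q ^ 2 *
      (if podd (μ p) = true ∧ podd (μ q) = true then m.z p + m.z q else 1))

end StrandModel

end EvaluationAtStrands

section StrandOperators

variable {I podd n}

lemma mul_mul_signed {M : Type*} [Ring M] {A B w : M} {P P' : Prop} [Decidable P] [Decidable P']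
    (hAB : A * B = if P then -(B * A) else B * A) (hw : w ≠ 0 → (P ↔ P')) :
    A * (B * w) = if P' then -(B * (A * w)) else B * (A * w) := by
  by_cases h : w = 0
  · simp [h]
  · rw [← mul_assoc, hAB]
    by_cases hP : P
    · rw [if_pos hP, if_pos ((hw h).1 hP), neg_mul, mul_assoc]
    · rw [if_neg hP, if_neg (fun hP' => hP ((hw h).2 hP')), mul_assoc]

namespace StrandModel

variable {μ : Fin n → I} {F M : Type*} [CommRing F] [Ring M] [Algebra F M] [Algebra k F]
  [Algebra k M] [IsScalarTower k F M]
  (m : StrandModel podd μ F M) (t : Fin n → Fin n → F)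

lemma kap_mul_kap {p q s u : Fin n} (h1 : s ≠ p) (h2 : s ≠ q) (h3 : u ≠ p) (h4 : u ≠ q) :
    m.kap t p q * m.kap t s u =
    if podd (μ p) = true ∧ podd (μ q) = true ∧ podd (μ s) = true ∧ podd (μ u) = true then
      -(m.kap t s u * m.kap t p q) else m.kap t s u * m.kap t p q := by
  simp only [kap, smul_mul_smul_comm, m.dC_mul_dC h1 h2 h3 h4, mul_comm (t p q)]
  split_ifs <;> simp

lemma kap_mul_rho (p q s u : Fin n) :
    m.kap t p q * m.rho s u =
    if podd (μ p) = true ∧ podd (μ q) = true ∧ podd (μ s) = true ∧ podd (μ u) = true then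
      -(m.rho s u * m.kap t p q) else m.rho s u * m.kap t p q := by
  simp only [kap, rho, smul_mul_smul_comm, m.dC_mul_dX, mul_comm (t p q)]
  split_ifs <;> simp

lemma rho_mul_kap (p q s u : Fin n) :
    m.rho p q * m.kap t s u =
    if podd (μ p) = true ∧ podd (μ q) = true ∧ podd (μ s) = true ∧ podd (μ u) = true then
      -(m.kap t s u * m.rho p q) else m.kap t s u * m.rho p q := by
  simp only [kap, rho, smul_mul_smul_comm, m.dC_mul_dX, mul_comm (t s u)]
  split_ifs <;> first | (exfalso; tauto) | simp

lemma rho_mul_rho {p q s u : Fin n} (h1 : s ≠ p) (h2 : s ≠ q) (h3 : u ≠ p) (h4 : u ≠ q) :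
    m.rho p q * m.rho s u =
    if podd (μ p) = true ∧ podd (μ q) = true ∧ podd (μ s) = true ∧ podd (μ u) = true then
      -(m.rho s u * m.rho p q) else m.rho s u * m.rho p q := by
  simp only [rho, smul_mul_smul_comm, m.dX_mul_dX h1 h2 h3 h4, mul_comm (m.r p q)]
  split_ifs <;> simp

/-- Left multiplication by `X` of the strand at position `p`. -/
def xOp (p : Fin n) : Module.End k (Equiv.Perm (Fin n) → M) where
  toFun f g := m.X (g p) * f g
  map_add' f f' := by ext g; simp [mul_add]
  map_smul' c f := by ext g; simp

/-- Restriction to the arrangements of strands whose labels read `ν`. -/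
def eOp (_ : StrandModel podd μ F M) (ν : Fin n → I) :
    Module.End k (Equiv.Perm (Fin n) → M) where
  toFun f g := if (fun p => μ (g p)) = ν then f g else 0
  map_add' f f' := by ext g; simp only [Pi.add_apply]; split_ifs <;> simp
  map_smul' c f := by ext g; simp

/-- The crossing of the strands at positions `a`, `a + 1`. -/
def tauOp (a : Fin (n - 1)) : Module.End k (Equiv.Perm (Fin n) → M) where
  toFun f g := m.kap t (g (lo a)) (g (hi a)) * f (g * sperm a) + m.rho (g (lo a)) (g (hi a)) * f g
  map_add' f f' := by ext g; simp only [Pi.add_apply, mul_add]; abel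
  map_smul' c f := by ext g; simp

lemma xOp_apply (p : Fin n) (f : Equiv.Perm (Fin n) → M) (g : Equiv.Perm (Fin n)) :
    m.xOp k p f g = m.X (g p) * f g := rfl

lemma eOp_apply (ν : Fin n → I) (f : Equiv.Perm (Fin n) → M) (g : Equiv.Perm (Fin n)) :
    m.eOp k ν f g = if (fun p => μ (g p)) = ν then f g else 0 := rfl

lemma tauOp_apply (a : Fin (n - 1)) (f : Equiv.Perm (Fin n) → M) (g : Equiv.Perm (Fin n)) :
    m.tauOp k t a f g =
      m.kap t (g (lo a)) (g (hi a)) * f (g * sperm a) + m.rho (g (lo a)) (g (hi a)) * f g := rfl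

variable {ν : Fin n → I} {h : Equiv.Perm (Fin n) → M}

/-- `h` is supported on the arrangements of strands whose labels read `ν`. -/
def SupportedAt (_ : StrandModel podd μ F M) (ν : Fin n → I) (h : Equiv.Perm (Fin n) → M) : Prop :=
  ∀ g, h g ≠ 0 → ∀ p, ν p = μ (g p)

lemma supportedAt_eOp (f : Equiv.Perm (Fin n) → M) : m.SupportedAt ν (m.eOp k ν f) := by
  intro g hg p
  rw [eOp_apply] at hg
  have : (fun p => μ (g p)) = ν := by
    by_contra h
    exact hg (if_neg h)
  rw [← this]

variable {k} {m}

lemma xOp_xOp (hh : m.SupportedAt ν h) (p q : Fin n) : m.xOp k p (m.xOp k q h) =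
    if p ≠ q ∧ podd (ν p) ∧ podd (ν q) then -(m.xOp k q (m.xOp k p h))
    else m.xOp k q (m.xOp k p h) := by
  funext g
  rw [ite_apply]
  simp only [Pi.neg_apply, xOp_apply]
  exact mul_mul_signed (m.X_mul_X_comm _ _) fun hg => by
    rw [hh g hg p, hh g hg q, g.injective.ne_iff]

lemma tauOp_xOp (hh : m.SupportedAt ν h) (a : Fin (n - 1)) (p : Fin n) (h1 : p ≠ lo a)
    (h2 : p ≠ hi a) : m.tauOp k t a (m.xOp k p h) =
    if podd (ν p) ∧ podd (ν (lo a)) ∧ podd (ν (hi a)) then -(m.xOp k p (m.tauOp k t a h))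
    else m.xOp k p (m.tauOp k t a h) := by
  funext g
  rw [ite_apply]
  simp only [Pi.neg_apply, xOp_apply, tauOp_apply, Equiv.Perm.coe_mul, Function.comp_apply,
    sperm_of_ne h1 h2]
  rw [mul_mul_signed (P' := podd (ν p) ∧ podd (ν (lo a)) ∧ podd (ν (hi a)))
      (m.kap_mul_X t _ _ _) fun hg => by
        simp only [hh _ hg, Equiv.Perm.coe_mul, Function.comp_apply, sperm_of_ne h1 h2, sperm_lo,
          sperm_hi]
        tauto,
    mul_mul_signed (P' := podd (ν p) ∧ podd (ν (lo a)) ∧ podd (ν (hi a)))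
      (m.rho_mul_X (g.injective.ne h1) (g.injective.ne h2)) fun hg => by simp only [hh _ hg]]
  split_ifs
  · rw [mul_add, neg_add]
  · rw [mul_add]

lemma tauOp_xOp_hi (hh : m.SupportedAt ν h) (a : Fin (n - 1)) :
    m.tauOp k t a (m.xOp k (hi a) h)
      - (if podd (ν (lo a)) ∧ podd (ν (hi a)) then -(m.xOp k (lo a) (m.tauOp k t a h))
        else m.xOp k (lo a) (m.tauOp k t a h)) = if ν (lo a) = ν (hi a) then h else 0 := by
  funext g
  rw [Pi.sub_apply, ite_apply, ite_apply]
  simp only [Pi.neg_apply, xOp_apply, tauOp_apply, Equiv.Perm.coe_mul, Function.comp_apply,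
    sperm_hi, Pi.zero_apply]
  have e1 := mul_mul_signed (P' := podd (ν (lo a)) ∧ podd (ν (hi a))) (w := h (g * sperm a))
      (m.kap_mul_X t (g (lo a)) (g (hi a)) (g (lo a))) fun hg => by
        simp only [hh _ hg, Equiv.Perm.coe_mul, Function.comp_apply, sperm_lo, sperm_hi]
        tauto
  rw [e1]
  by_cases hg : h g = 0
  · simp only [hg, mul_zero, add_zero, ite_self]
    split_ifs <;> abel
  · by_cases hμ : ν (lo a) = ν (hi a)
    · have e2 := m.rho_mul_X_sub (g.injective.ne (lo_ne_hi a))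
        (by rw [← hh g hg, ← hh g hg, hμ])
      rw [if_pos hμ]
      simp only [hh g hg]
      have e3 := congrArg (· * h g) e2
      split_ifs at e3 ⊢ <;>
      · simp only [sub_mul, neg_mul, one_mul, mul_assoc] at e3
        simp only [mul_add]
        linear_combination (norm := abel) e3
    · rw [if_neg hμ, m.rho_of_ne (by rw [← hh g hg, ← hh g hg]; exact hμ)]
      split_ifs <;> simp

lemma xOp_tauOp_hi (hh : m.SupportedAt ν h) (a : Fin (n - 1)) :
    m.xOp k (hi a) (m.tauOp k t a h)
      - (if podd (ν (lo a)) ∧ podd (ν (hi a)) then -(m.tauOp k t a (m.xOp k (lo a) h))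
        else m.tauOp k t a (m.xOp k (lo a) h)) = if ν (lo a) = ν (hi a) then h else 0 := by
  funext g
  rw [Pi.sub_apply, ite_apply, ite_apply]
  simp only [Pi.neg_apply, xOp_apply, tauOp_apply, Equiv.Perm.coe_mul, Function.comp_apply,
    sperm_lo, Pi.zero_apply]
  have e1 := mul_mul_signed (P' := podd (ν (lo a)) ∧ podd (ν (hi a))) (w := h (g * sperm a))
      (m.kap_mul_X t (g (lo a)) (g (hi a)) (g (hi a))) fun hg => by
        simp only [hh _ hg, Equiv.Perm.coe_mul, Function.comp_apply, sperm_lo, sperm_hi]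
        tauto
  rw [e1]
  by_cases hg : h g = 0
  · simp only [hg, mul_zero, add_zero, ite_self]
    split_ifs <;> abel
  · by_cases hμ : ν (lo a) = ν (hi a)
    · have e2 := m.X_mul_rho_sub (g.injective.ne (lo_ne_hi a))
        (by rw [← hh g hg, ← hh g hg, hμ])
      rw [if_pos hμ]
      simp only [hh g hg]
      have e3 := congrArg (· * h g) e2
      split_ifs at e3 ⊢ <;>
      · simp only [sub_mul, neg_mul, one_mul, mul_assoc] at e3
        simp only [mul_add]
        linear_combination (norm := abel) e3
    · rw [if_neg hμ, m.rho_of_ne (by rw [← hh g hg, ← hh g hg]; exact hμ)]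
      split_ifs <;> simp

lemma tauOp_tauOp {Qs : Fin n → Fin n → F} (ht : m.Compatible t Qs) (a : Fin (n - 1))
    (g : Equiv.Perm (Fin n)) :
    m.tauOp k t a (m.tauOp k t a h) g = Qs (g (lo a)) (g (hi a)) • h g := by
  have hne := g.injective.ne (lo_ne_hi a)
  have e1 := congrArg (· * h (g * sperm a)) (m.kap_mul_rho_swap t hne)
  have e2 := congrArg (· * h g) (m.kap_mul_kap_swap ht hne)
  simp only [add_mul, zero_mul, smul_mul_assoc, one_mul, mul_assoc] at e1 e2
  simp only [tauOp_apply, Equiv.Perm.coe_mul, Function.comp_apply, sperm_lo, sperm_hi,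
    mul_sperm_mul_sperm, mul_add]
  linear_combination (norm := abel) e1 + e2

lemma tauOp_comm (hh : m.SupportedAt ν h) (a b : Fin (n - 1))
    (hab : (a : ℕ) + 1 < (b : ℕ) ∨ (b : ℕ) + 1 < (a : ℕ)) :
    m.tauOp k t a (m.tauOp k t b h) =
    if podd (ν (lo a)) ∧ podd (ν (hi a)) ∧ podd (ν (lo b)) ∧ podd (ν (hi b)) then
      -(m.tauOp k t b (m.tauOp k t a h)) else m.tauOp k t b (m.tauOp k t a h) := by
  have n1 : lo b ≠ lo a := by simp [lo, Fin.ext_iff]; omega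
  have n2 : lo b ≠ hi a := by simp [lo, hi, Fin.ext_iff]; omega
  have n3 : hi b ≠ lo a := by simp [lo, hi, Fin.ext_iff]; omega
  have n4 : hi b ≠ hi a := by simp [hi, Fin.ext_iff]; omega
  have s1 := sperm_of_ne n1 n2
  have s2 := sperm_of_ne n3 n4
  have s3 := sperm_of_ne n1.symm n3.symm
  have s4 := sperm_of_ne n2.symm n4.symm
  funext g
  rw [ite_apply]
  simp only [Pi.neg_apply, tauOp_apply, Equiv.Perm.coe_mul, Function.comp_apply, s1, s2, s3, s4,
    mul_add]
  rw [mul_assoc g (sperm b), ← sperm_comm hab, ← mul_assoc g]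
  have g1 := g.injective.ne n1
  have g2 := g.injective.ne n2
  have g3 := g.injective.ne n3
  have g4 := g.injective.ne n4
  have key : ∀ g' : Equiv.Perm (Fin n),
      ((g' = g ∨ g' = g * sperm a) ∨ g' = g * sperm b ∨ g' = g * sperm a * sperm b) →
      h g' ≠ 0 → ((podd (μ (g (lo a))) = true ∧ podd (μ (g (hi a))) = true ∧
        podd (μ (g (lo b))) = true ∧ podd (μ (g (hi b))) = true) ↔
      (podd (ν (lo a)) ∧ podd (ν (hi a)) ∧ podd (ν (lo b)) ∧ podd (ν (hi b)))) := by
    rintro g' hg' hg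
    simp only [hh g' hg]
    rcases hg' with (rfl | rfl) | rfl | rfl <;>
      simp only [Equiv.Perm.coe_mul, Function.comp_apply, s1, s2, s3, s4, sperm_lo, sperm_hi] <;>
      tauto
  rw [mul_mul_signed (m.kap_mul_kap t g1 g2 g3 g4) (key _ (by simp)),
    mul_mul_signed (m.kap_mul_rho t _ _ _ _) (key _ (by simp)),
    mul_mul_signed (m.rho_mul_kap t _ _ _ _) (key _ (by simp)),
    mul_mul_signed (m.rho_mul_rho g1 g2 g3 g4) (key _ (by simp))]
  split_ifs <;> abel

end StrandModel

end StrandOperators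

section StrandRepresentation

variable {I podd n}

namespace StrandModel

variable {μ : Fin n → I} {F M : Type*} [CommRing F] [Ring M] [Algebra F M] [Algebra k F]
  [Algebra k M] [IsScalarTower k F M]
  {m : StrandModel podd μ F M} (t : Fin n → Fin n → F) {Qs : Fin n → Fin n → F}
  {ν : Fin n → I} {h : Equiv.Perm (Fin n) → M}

lemma tauOp_braid (ht : m.Compatible t Qs) (hdiag : ∀ p q, p ≠ q → μ p = μ q → Qs p q = 0)
    (a b : Fin (n - 1)) (hab : (b : ℕ) = (a : ℕ) + 1) (g : Equiv.Perm (Fin n)) :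
    m.tauOp k t b (m.tauOp k t a (m.tauOp k t b h)) g
      - m.tauOp k t a (m.tauOp k t b (m.tauOp k t a h)) g =
    (((if podd (μ (g (lo a))) = true ∧ podd (μ (g (hi a))) = true then -1 else 1) *
      m.r (g (lo a)) (g (hi b)) * (Qs (g (hi a)) (g (hi b)) - Qs (g (lo a)) (g (hi a)))) •
      m.dX (g (lo a)) (g (hi b))) * h g := by
  have hlb : lo b = hi a := by simp [lo, hi, hab]
  have n1 : lo a ≠ hi b := by simp [lo, hi, Fin.ext_iff]; omega
  have n2 : hi a ≠ hi b := by simp [hi, Fin.ext_iff]; omega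
  have n3 : lo a ≠ hi a := lo_ne_hi a
  have s1 : sperm a (hi b) = hi b := sperm_of_ne n1.symm n2.symm
  have s2 : sperm b (lo a) = lo a := sperm_of_ne (by rwa [hlb]) n1
  have s3 : sperm b (hi a) = hi b := by rw [← hlb, sperm_lo]
  have s4 : sperm b (hi b) = hi a := by rw [sperm_hi, hlb]
  have hs : g * sperm b * sperm a * sperm b = g * sperm a * sperm b * sperm a := by
    simp only [mul_assoc]
    rw [← mul_assoc (sperm b), ← sperm_braid hab, mul_assoc]
  have gpq := g.injective.ne n3
  have gqs := g.injective.ne n2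
  have gps := g.injective.ne n1
  simp only [tauOp_apply, hlb, Equiv.Perm.coe_mul, Function.comp_apply, s1, s2, s3, s4, sperm_lo,
    sperm_hi, mul_sperm_mul_sperm, mul_add, hs]
  have e1 := congrArg (· * h (g * sperm a * sperm b * sperm a)) (m.kap_braid t gpq gqs gps)
  have e2 := congrArg (· * h (g * sperm b * sperm a)) (m.kap_kap_rho t (g (lo a)) (g (hi a))
    (g (hi b)))
  have e3 := congrArg (· * h (g * sperm a * sperm b)) (m.rho_kap_kap t (g (lo a)) (g (hi a))
    (g (hi b)))
  have e4 := congrArg (· * h (g * sperm b)) (m.kap_rho_rho_left t gpq gqs gps)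
  have e5 := congrArg (· * h (g * sperm a)) (m.kap_rho_rho_right t gpq gqs gps)
  have e6 := congrArg (· * h g) (m.braid_defect ht (fun p q h1 h2 => hdiag p q h2 h1) gpq gqs gps)
  have assoc : ∀ x y z : M, x * y * z = x * (y * z) := mul_assoc
  simp only [add_mul, sub_mul, assoc] at e1 e2 e3 e4 e5 e6
  rw [← e6]
  linear_combination (norm := abel) e1 + e2 + e3 + e4 + e5

/-- Evaluation `f(x₀, x₁, x₂) ↦ f(X, Y, Z)` of a noncommutative polynomial. -/
noncomputable def evalTriple (X Y Z : M) : FreeAlgebra k (Fin 3) →ₐ[k] M :=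
  FreeAlgebra.lift k fun t : Fin 3 => if t = 0 then X else if t = 1 then Y else Z

@[simp] lemma evalTriple_zero (X Y Z : M) : evalTriple k X Y Z (FreeAlgebra.ι k 0) = X := by
  simp [evalTriple]

@[simp] lemma evalTriple_one (X Y Z : M) : evalTriple k X Y Z (FreeAlgebra.ι k 1) = Y := by
  simp [evalTriple]

@[simp] lemma evalTriple_two (X Y Z : M) : evalTriple k X Y Z (FreeAlgebra.ι k 2) = Z := by
  simp [evalTriple]

lemma evalTriple_sub21 (X Y Z : M) (f : FreeAlgebra k (Fin 2)) :
    evalTriple k X Y Z (sub21 k f) = evalPair k Z Y f := by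
  have : (evalTriple k X Y Z).comp (sub21 k) = evalPair k Z Y := by
    ext t
    fin_cases t <;> simp
  exact DFunLike.congr_fun this f

lemma evalTriple_sub01 (X Y Z : M) (f : FreeAlgebra k (Fin 2)) :
    evalTriple k X Y Z (sub01 k f) = evalPair k X Y f := by
  have : (evalTriple k X Y Z).comp (sub01 k) = evalPair k X Y := by
    ext t
    fin_cases t <;> simp
  exact DFunLike.congr_fun this f

variable {k} {Qrep : I → I → FreeAlgebra k (Fin 2)}

lemma evalTriple_eq_of_mkA3_eq {p q s : Fin n} (hpq : p ≠ q) (hqs : q ≠ s) (hps : p ≠ s)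
    (h : μ p = μ s) {f f' : FreeAlgebra k (Fin 3)}
    (hf : mkA3 k I podd (μ p) (μ q) f = mkA3 k I podd (μ p) (μ q) f') :
    evalTriple k (m.X p) (m.X q) (m.X s) f = evalTriple k (m.X p) (m.X q) (m.X s) f' := by
  refine eq_of_mkA3_eq _ (fun i j hij => ?_) hf
  have c1 := m.X_mul_X_comm q p
  have c2 := m.X_mul_X_comm s p
  have c3 := m.X_mul_X_comm s q
  rw [← h] at c2 c3
  simp only [hpq.symm, hqs.symm, hps.symm, ne_eq, not_false_eq_true, true_and] at c1 c2 c3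
  fin_cases i <;> fin_cases j <;> simp at hij <;> simp <;>
    simp only [c1, c2, c3] <;> congr 1 <;> simp [and_comm]

/-- The divided difference of `Q` acts through the divided difference of the scalars `Qs`. -/
lemma evalTriple_divided_difference (hsymm : ∀ p q, Qs p q = Qs q p)
    (hev : ∀ p q, p ≠ q → evalPair k (m.X p) (m.X q) (Qrep (μ p) (μ q)) = Qs p q • (1 : M))
    {p q s : Fin n} (hpq : p ≠ q) (hqs : q ≠ s) (hps : p ≠ s) (h : μ p = μ s)
    {D d : FreeAlgebra k (Fin 3)}
    (hd : evalTriple k (m.X p) (m.X q) (m.X s) d = (m.z s - m.z p) • (1 : M))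
    (hD : mkA3 k I podd (μ p) (μ q) (D * d) = mkA3 k I podd (μ p) (μ q)
      (sub21 k (Qrep (μ p) (μ q)) - sub01 k (Qrep (μ p) (μ q)))) :
    evalTriple k (m.X p) (m.X q) (m.X s) D = (m.r p s * (Qs q s - Qs p q)) • (1 : M) := by
  have e := evalTriple_eq_of_mkA3_eq (m := m) hpq hqs hps h hD
  have h1 := hev s q hqs.symm
  rw [← h] at h1
  rw [map_mul, hd, map_sub, evalTriple_sub21, evalTriple_sub01, h1, hev p q hpq, hsymm s q,
    mul_smul_comm, mul_one] at e
  have hr := m.r_mul hps h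
  linear_combination (norm := module)
    m.r p s • e - hr • evalTriple k (m.X p) (m.X q) (m.X s) D

lemma lift_apply_pointwise {T : Type*} (φ : T → Module.End k (Equiv.Perm (Fin n) → M))
    (Y : T → Equiv.Perm (Fin n) → M) (hφ : ∀ i f g, φ i f g = Y i g * f g)
    (q : FreeAlgebra k T) (f : Equiv.Perm (Fin n) → M) (g : Equiv.Perm (Fin n)) :
    FreeAlgebra.lift k φ q f g = FreeAlgebra.lift k (fun i => Y i g) q * f g := by
  induction q using FreeAlgebra.induction generalizing f with
  | grade0 r => simp [Algebra.algebraMap_eq_smul_one]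
  | grade1 i => simp [hφ]
  | add a b ha hb => simp [ha, hb, add_mul]
  | mul a b ha hb => simp [ha, hb, mul_assoc]

variable (k) (m)

/-- The free algebra on the generators of `R_n(Q)` acting on the strand model. -/
noncomputable def freeRep : RFree k I n →ₐ[k] Module.End k (Equiv.Perm (Fin n) → M) :=
  FreeAlgebra.lift k fun
    | RGen.x p => m.xOp k p
    | RGen.tau a => m.tauOp k t a
    | RGen.e ν => m.eOp k ν

@[simp] lemma freeRep_xF (p : Fin n) : m.freeRep k t (xF k I n p) = m.xOp k p := by
  simp [freeRep, xF]

@[simp] lemma freeRep_tauF (a : Fin (n - 1)) : m.freeRep k t (tauF k I n a) = m.tauOp k t a := by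
  simp [freeRep, tauF]

@[simp] lemma freeRep_eF (ν : Fin n → I) : m.freeRep k t (eF k I n ν) = m.eOp k ν := by
  simp [freeRep, eF]

lemma freeRep_evalX (a : Fin (n - 1)) (q : FreeAlgebra k (Fin 2)) (f : Equiv.Perm (Fin n) → M)
    (g : Equiv.Perm (Fin n)) : m.freeRep k t (evalX k I n a q) f g =
      evalPair k (m.X (g (lo a))) (m.X (g (hi a))) q * f g := by
  have e : (m.freeRep k t).comp (evalX k I n a) =
      FreeAlgebra.lift k fun i : Fin 2 => if i = 0 then m.xOp k (lo a) else m.xOp k (hi a) := by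
    ext1
    funext i
    fin_cases i <;> simp [evalX]
  have := DFunLike.congr_fun e q
  rw [AlgHom.comp_apply] at this
  rw [this, lift_apply_pointwise _
    (fun i g => if i = 0 then m.X (g (lo a)) else m.X (g (hi a))) (fun i f g => by
      fin_cases i <;> simp [xOp_apply])]
  rfl

lemma freeRep_evalX3 (a b : Fin (n - 1)) (q : FreeAlgebra k (Fin 3))
    (f : Equiv.Perm (Fin n) → M) (g : Equiv.Perm (Fin n)) :
    m.freeRep k t (evalX3 k I n a b q) f g =
      evalTriple k (m.X (g (lo a))) (m.X (g (hi a))) (m.X (g (hi b))) q * f g := by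
  have e : (m.freeRep k t).comp (evalX3 k I n a b) =
      FreeAlgebra.lift k fun i : Fin 3 => if i = 0 then m.xOp k (lo a) else
        if i = 1 then m.xOp k (hi a) else m.xOp k (hi b) := by
    ext1
    funext i
    fin_cases i <;> simp [evalX3]
  have := DFunLike.congr_fun e q
  rw [AlgHom.comp_apply] at this
  rw [this, lift_apply_pointwise _
    (fun i g => if i = 0 then m.X (g (lo a)) else if i = 1 then m.X (g (hi a))
      else m.X (g (hi b))) (fun i f g => by
      fin_cases i <;> simp [xOp_apply])]
  rfl

variable {k}

/-- The operators on the strand model satisfy the defining relations of `R_n(Q)`. -/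
lemma freeRep_rel (hsymm : ∀ p q, Qs p q = Qs q p)
    (hdiag : ∀ p q, p ≠ q → μ p = μ q → Qs p q = 0)
    (hev : ∀ p q, p ≠ q → evalPair k (m.X p) (m.X q) (Qrep (μ p) (μ q)) = Qs p q • (1 : M))
    (ht : m.Compatible t Qs) ⦃x y : RFree k I n⦄ (hxy : RRel k I podd n Qrep x y) :
    m.freeRep k t x = m.freeRep k t y := by
  refine LinearMap.ext fun f => ?_
  cases hxy with
  | e_orth ν ν' h =>
    funext g
    simp only [map_mul, freeRep_eF, Module.End.mul_apply, eOp_apply, map_zero,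
      LinearMap.zero_apply, Pi.zero_apply]
    split_ifs with h1 h2 <;> first | rfl | exact absurd (h1.symm.trans h2) h
  | e_idem ν =>
    funext g
    simp only [map_mul, freeRep_eF, Module.End.mul_apply, eOp_apply]
    split_ifs <;> rfl
  | e_sum =>
    funext g
    simp [LinearMap.sum_apply, Finset.sum_apply, eOp_apply]
  | xe p ν =>
    funext g
    simp [eOp_apply, xOp_apply]
  | taue a ν =>
    funext g
    simp only [map_mul, freeRep_eF, freeRep_tauF, Module.End.mul_apply, eOp_apply, tauOp_apply]
    have e : ((fun p => μ ((g * sperm a) p)) = ν) ↔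
        ((fun p => μ (g p)) = fun p => ν (sperm a p)) := by
      constructor
      · rintro rfl; funext p; simp
      · intro h; funext p; simpa using congrFun h (sperm a p)
    by_cases h1 : (fun p => μ (g p)) = fun p => ν (sperm a p)
    · rw [if_pos (e.2 h1), if_pos h1]
      split_ifs with h2
      · rfl
      · have hne : μ (g (lo a)) ≠ μ (g (hi a)) := by
          intro hμ
          apply h2
          funext p
          have h3 := congrFun h1 p
          have h4 : μ (g (lo a)) = ν (hi a) := by simpa using congrFun h1 (lo a)
          have h5 : μ (g (hi a)) = ν (lo a) := by simpa using congrFun h1 (hi a)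
          by_cases hp : p = lo a
          · rw [hp, ← h5, ← hμ]
          · by_cases hp' : p = hi a
            · rw [hp', ← h4, hμ]
            · rwa [sperm_of_ne hp hp'] at h3
        simp [m.rho_of_ne hne]
    · rw [if_neg (fun h => h1 (e.1 h)), if_neg h1, mul_zero, zero_add]
      split_ifs with h2
      · have hne : μ (g (lo a)) ≠ μ (g (hi a)) := by
          intro hμ
          apply h1
          funext p
          rw [← h2]
          by_cases hp : p = lo a
          · simp [hp, hμ]
          · by_cases hp' : p = hi a
            · simp [hp', hμ]
            · rw [sperm_of_ne hp hp']
        rw [m.rho_of_ne hne, zero_mul]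
      · rw [mul_zero]
  | xx p q ν =>
    have hh := m.supportedAt_eOp k (ν := ν) f
    simp only [map_mul, apply_ite (m.freeRep k t), map_neg, freeRep_xF, freeRep_eF,
      Module.End.mul_apply, xOp_xOp hh p q]
    split_ifs <;> rfl
  | taux a p ν h1 h2 =>
    have hh := m.supportedAt_eOp k (ν := ν) f
    simp only [map_mul, apply_ite (m.freeRep k t), map_neg, freeRep_xF, freeRep_eF, freeRep_tauF,
      Module.End.mul_apply, tauOp_xOp t hh a p h1 h2]
    split_ifs <;> rfl
  | taux1 a ν =>
    have hh := m.supportedAt_eOp k (ν := ν) f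
    have key := tauOp_xOp_hi (k := k) t hh a
    simp only [map_mul, map_sub, apply_ite (m.freeRep k t), map_neg, freeRep_xF, freeRep_eF,
      freeRep_tauF, LinearMap.sub_apply, map_zero]
    split_ifs at key ⊢ <;> exact key
  | taux2 a ν =>
    have hh := m.supportedAt_eOp k (ν := ν) f
    have key := xOp_tauOp_hi (k := k) t hh a
    simp only [map_mul, map_sub, apply_ite (m.freeRep k t), map_neg, freeRep_xF, freeRep_eF,
      freeRep_tauF, LinearMap.sub_apply, map_zero]
    split_ifs at key ⊢ <;> exact key
  | tausq a ν =>
    have hh := m.supportedAt_eOp k (ν := ν) f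
    funext g
    simp only [map_mul, freeRep_eF, freeRep_tauF, Module.End.mul_apply, tauOp_tauOp t ht,
      freeRep_evalX]
    by_cases hg : m.eOp k ν f g = 0
    · simp [hg]
    · rw [hh g hg, hh g hg, hev _ _ (g.injective.ne (lo_ne_hi a)), smul_mul_assoc, one_mul]
  | tautau a b ν h =>
    have hh := m.supportedAt_eOp k (ν := ν) f
    simp only [map_mul, apply_ite (m.freeRep k t), map_neg, freeRep_eF, freeRep_tauF,
      Module.End.mul_apply, tauOp_comm t hh a b h]
    split_ifs <;> rfl
  | braid_even a b hab ν hsame heven D hD =>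
    have hh := m.supportedAt_eOp k (ν := ν) f
    have n1 : lo a ≠ hi b := by simp [lo, hi, Fin.ext_iff]; omega
    have n2 : hi a ≠ hi b := by simp [hi, Fin.ext_iff]; omega
    funext g
    simp only [map_mul, map_sub, freeRep_eF, freeRep_tauF, Module.End.mul_apply,
      LinearMap.sub_apply, Pi.sub_apply, tauOp_braid k t ht hdiag a b hab, freeRep_evalX3]
    by_cases hg : m.eOp k ν f g = 0
    · simp [hg]
    · rw [hh g hg, hh g hg] at hD hsame
      rw [hh g hg] at heven
      rw [evalTriple_divided_difference hsymm hev (g.injective.ne (lo_ne_hi a))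
        (g.injective.ne n2) (g.injective.ne n1) hsame
        (by simp [m.X_even _ heven, m.X_even _ (hsame ▸ heven), sub_smul]) hD]
      simp [heven, m.dX_of_even heven]
  | braid_odd a b hab ν hsame hodd D hD =>
    have hh := m.supportedAt_eOp k (ν := ν) f
    have n1 : lo a ≠ hi b := by simp [lo, hi, Fin.ext_iff]; omega
    have n2 : hi a ≠ hi b := by simp [hi, Fin.ext_iff]; omega
    funext g
    simp only [map_mul, map_sub, map_neg, freeRep_eF, freeRep_tauF, freeRep_xF,
      apply_ite (m.freeRep k t), LinearMap.sub_apply, Pi.sub_apply, Module.End.mul_apply,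
      tauOp_braid k t ht hdiag a b hab]
    by_cases hg : m.eOp k ν f g = 0
    · split_ifs <;> simp [hg, freeRep_evalX3, xOp_apply]
    · rw [hh g hg, hh g hg] at hD hsame
      rw [hh g hg] at hodd
      have hD' := evalTriple_divided_difference hsymm hev (g.injective.ne (lo_ne_hi a))
        (g.injective.ne n2) (g.injective.ne n1) hsame
        (by simp [m.X_mul_self _ hodd, m.X_mul_self _ (hsame ▸ hodd), sub_smul]) hD
      rw [hh g hg, m.dX_of_odd hodd (hsame ▸ hodd)]
      cases hq : podd (μ (g (hi a)))
      · simp [freeRep_evalX3, xOp_apply, hD', sub_mul, smul_sub]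
      · simp [hodd, freeRep_evalX3, xOp_apply, hD', add_mul, smul_sub]
        abel
  | braid_zero a b hab ν hdiff =>
    have hh := m.supportedAt_eOp k (ν := ν) f
    funext g
    simp only [map_mul, map_sub, freeRep_eF, freeRep_tauF, Module.End.mul_apply,
      LinearMap.sub_apply, Pi.sub_apply, tauOp_braid k t ht hdiag a b hab, map_zero,
      LinearMap.zero_apply, Pi.zero_apply]
    by_cases hg : m.eOp k ν f g = 0
    · simp [hg]
    · rw [hh g hg, hh g hg] at hdiff
      simp [m.r_of_ne hdiff]

end StrandModel

end StrandRepresentation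

section CliffordModel

lemma linearIndependent_of_eq {ι R M : Type*} [Semiring R] [AddCommMonoid M] [Module R M]
    {v w : ι → M} (hv : LinearIndependent R v) (e : ∀ i, w i = v i) : LinearIndependent R w :=
  funext e ▸ hv

lemma X_pow_sub_X_pow_mem_nonZeroDivisors {σ : Type*} [LinearOrder σ] [WellFoundedGT σ]
    {p q : σ} (hpq : p ≠ q) {d : ℕ}
    (hd : d ≠ 0) : (MvPolynomial.X q ^ d - MvPolynomial.X p ^ d : MvPolynomial σ k) ∈
      nonZeroDivisors (MvPolynomial σ k) := by
  classical
  nontriviality k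
  let m : MonomialOrder σ := MonomialOrder.lex
  have deg (s : σ) : m.degree (MvPolynomial.X s ^ d : MvPolynomial σ k) = Finsupp.single s d := by
    rw [MvPolynomial.X_pow_eq_monomial, m.degree_monomial, if_neg one_ne_zero]
  have mon (s : σ) : m.Monic (MvPolynomial.X s ^ d : MvPolynomial σ k) := m.monic_X.pow
  have key {p q : σ} (h : m.toSyn (Finsupp.single p d) < m.toSyn (Finsupp.single q d)) :
      (MvPolynomial.X q ^ d - MvPolynomial.X p ^ d : MvPolynomial σ k) ∈
        nonZeroDivisors (MvPolynomial σ k) := by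
    apply m.mem_nonZeroDivisors_of_leadingCoeff_mem_nonZeroDivisors
    have := (mon q).add_of_lt (g := -MvPolynomial.X p ^ d) (by rwa [m.degree_neg, deg, deg])
    rw [← sub_eq_add_neg] at this
    rw [this.leadingCoeff_eq_one]
    exact one_mem _
  have hne : m.toSyn (Finsupp.single p d) ≠ m.toSyn (Finsupp.single q d) := by
    intro h
    exact hpq ((Finsupp.single_left_inj hd).1 (m.toSyn.injective h))
  rcases lt_or_gt_of_ne hne with h | h
  · exact key h
  · have := key h
    rw [← neg_sub, ← neg_one_mul]
    exact mul_mem (isUnit_one.neg.mem_nonZeroDivisors) this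

variable {F : Type*} [CommRing F]

/-- The `j`-th generator of the Clifford algebra on countably many generators, acting on functions
of countably many signs. -/
def cliffordGen (F : Type*) [CommRing F] (j : ℕ) : Module.End F ((ℕ → ℤˣ) → F) where
  toFun f h := (∏ i ∈ Finset.range j, h i) • f (Function.update h j (-h j))
  map_add' f f' := by ext h; simp
  map_smul' c f := by ext h; simp [mul_smul_comm]

lemma cliffordGen_apply (j : ℕ) (f : (ℕ → ℤˣ) → F) (h : ℕ → ℤˣ) :
    cliffordGen F j f h = (∏ i ∈ Finset.range j, h i) • f (Function.update h j (-h j)) := rfl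

lemma prod_range_update_of_le {i j : ℕ} (hij : i ≤ j) (h : ℕ → ℤˣ) (ε : ℤˣ) :
    ∏ l ∈ Finset.range i, Function.update h j ε l = ∏ l ∈ Finset.range i, h l := by
  refine Finset.prod_congr rfl fun l hl => ?_
  rw [Function.update_of_ne]
  have := Finset.mem_range.1 hl
  omega

lemma prod_range_update_neg {i j : ℕ} (hij : i < j) (h : ℕ → ℤˣ) :
    ∏ l ∈ Finset.range j, Function.update h i (-h i) l = -∏ l ∈ Finset.range j, h l := by
  have hi := Finset.mem_range.2 hij
  rw [Finset.prod_update_of_mem hi, ← Finset.mul_prod_erase _ _ hi, Finset.sdiff_singleton_eq_erase,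
    neg_mul]

lemma cliffordGen_mul_self (j : ℕ) : cliffordGen F j * cliffordGen F j = 1 := by
  refine LinearMap.ext fun f => funext fun h => ?_
  simp only [Module.End.mul_apply, cliffordGen_apply, prod_range_update_of_le le_rfl, smul_smul]
  simp

lemma cliffordGen_mul_of_lt {i j : ℕ} (hij : i < j) :
    cliffordGen F i * cliffordGen F j = -(cliffordGen F j * cliffordGen F i) := by
  refine LinearMap.ext fun f => funext fun h => ?_
  simp only [Module.End.mul_apply, LinearMap.neg_apply, Pi.neg_apply, cliffordGen_apply,
    prod_range_update_neg hij, prod_range_update_of_le hij.le, Function.update_of_ne hij.ne,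
    Function.update_of_ne hij.ne', smul_smul, Function.update_comm hij.ne]
  rw [mul_neg, mul_comm, Units.neg_smul]

lemma cliffordGen_mul {i j : ℕ} (hij : i ≠ j) :
    cliffordGen F i * cliffordGen F j = -(cliffordGen F j * cliffordGen F i) := by
  rcases lt_or_gt_of_ne hij with h | h
  · exact cliffordGen_mul_of_lt h
  · rw [cliffordGen_mul_of_lt h, neg_neg]

variable {I podd n}

/-- The strand model over the total fraction ring `F` of the polynomial ring in `y_1, …, y_n`:
`X_p` is `y_p` on even strands and `y_p` times a Clifford generator on odd strands. -/
noncomputable def cliffordModel (μ : Fin n → I) :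
    StrandModel podd μ (FractionRing (MvPolynomial (Fin n) k))
      (Module.End (FractionRing (MvPolynomial (Fin n) k))
        ((ℕ → ℤˣ) → FractionRing (MvPolynomial (Fin n) k))) where
  z p := algebraMap (MvPolynomial (Fin n) k) _
    (MvPolynomial.X p ^ if podd (μ p) = true then 2 else 1)
  u p q := Ring.inverse (algebraMap (MvPolynomial (Fin n) k) _
    (MvPolynomial.X q ^ (if podd (μ q) = true then 2 else 1) -
      MvPolynomial.X p ^ if podd (μ p) = true then 2 else 1))
  X p := algebraMap (MvPolynomial (Fin n) k) (FractionRing (MvPolynomial (Fin n) k))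
    (MvPolynomial.X p) • if podd (μ p) = true then cliffordGen _ (2 * p) else 1
  C p := cliffordGen _ (2 * p + 1)
  X_even p hp := by simp [hp]
  X_mul_self p hp := by
    simp only [hp, if_true, smul_mul_smul_comm, cliffordGen_mul_self, pow_two, map_mul]
  X_mul_X p q hpq hp hq := by
    have : 2 * (p : ℕ) ≠ 2 * q := by have := Fin.val_ne_of_ne hpq; omega
    simp only [hp, hq, if_true, smul_mul_smul_comm, cliffordGen_mul this, smul_neg]
    rw [mul_comm (algebraMap _ _ _)]
  C_mul_self p _ := cliffordGen_mul_self _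
  C_mul_C p q hpq _ _ := cliffordGen_mul (by have := Fin.val_ne_of_ne hpq; omega)
  C_mul_X p q hp hq := by
    simp only [hq, if_true, mul_smul_comm, smul_mul_assoc]
    rw [cliffordGen_mul (by omega), smul_neg]
  u_mul p q hpq h := by
    rw [← map_sub]
    apply Ring.inverse_mul_cancel
    apply IsLocalization.map_units (M := nonZeroDivisors (MvPolynomial (Fin n) k)) _
      (⟨_, _⟩ : nonZeroDivisors (MvPolynomial (Fin n) k))
    rw [h]
    exact X_pow_sub_X_pow_mem_nonZeroDivisors k hpq (by split_ifs <;> simp)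

lemma cliffordModel_X_apply (μ : Fin n → I) (p : Fin n)
    {f : (ℕ → ℤˣ) → FractionRing (MvPolynomial (Fin n) k)} {s : MvPolynomial (Fin n) k}
    (hf : ∀ h, ∃ ε : ℤˣ, f h = ε • algebraMap _ _ s) (h : ℕ → ℤˣ) :
    ∃ ε : ℤˣ, (cliffordModel (podd := podd) k μ).X p f h =
      ε • algebraMap _ _ (MvPolynomial.X p * s) := by
  simp only [cliffordModel, LinearMap.smul_apply, Pi.smul_apply, map_mul, smul_eq_mul]
  cases hp : podd (μ p)
  · obtain ⟨ε, hε⟩ := hf h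
    exact ⟨ε, by simp [hε, mul_smul_comm]⟩
  · obtain ⟨ε, hε⟩ := hf (Function.update h (2 * p) (-h (2 * p)))
    exact ⟨_, by
      simp only [cliffordGen_apply, if_true, hε]
      rw [smul_smul, mul_smul_comm]⟩

lemma cliffordModel_prod_apply (μ : Fin n → I) (g : Equiv.Perm (Fin n)) (a : Fin n → ℕ)
    (l : List (Fin n)) (h : ℕ → ℤˣ) :
    ∃ ε : ℤˣ, (l.map fun p => (cliffordModel (podd := podd) k μ).X (g p) ^ a p).prod 1 h =
      ε • algebraMap _ _ (l.map fun p => (MvPolynomial.X (g p) ^ a p :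
        MvPolynomial (Fin n) k)).prod := by
  induction l generalizing h with
  | nil => exact ⟨1, by simp⟩
  | cons p l ih =>
    simp only [List.map_cons, List.prod_cons]
    generalize a p = b
    induction b generalizing h with
    | zero => simpa using ih h
    | succ b hb =>
      simp only [pow_succ', mul_assoc]
      exact cliffordModel_X_apply k μ (g p) hb h

lemma linearIndependent_X_monomials (g : Equiv.Perm (Fin n)) :
    LinearIndependent k fun a : Fin n → ℕ =>
      ((List.finRange n).map fun p => (MvPolynomial.X (g p) ^ a p :
        MvPolynomial (Fin n) k)).prod := by
  have hi : Function.Injective fun a : Fin n → ℕ =>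
      Finsupp.equivFunOnFinite.symm (a ∘ g.symm) := fun a b hab =>
    g.symm.surjective.injective_comp_right (Finsupp.equivFunOnFinite.symm.injective hab)
  refine linearIndependent_of_eq ((MvPolynomial.basisMonomials (Fin n) k).linearIndependent.comp _ hi)
    fun a => ?_
  rw [← List.ofFn_eq_map, List.prod_ofFn, ← Equiv.prod_comp g.symm]
  simp [MvPolynomial.monomial_eq, Finsupp.prod_fintype]

/-- The monomials in the `X_p`, in any fixed order of the strands, are linearly independent. -/
lemma cliffordModel_linearIndependent (μ : Fin n → I) (g : Equiv.Perm (Fin n)) :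
    LinearIndependent k fun a : Fin n → ℕ =>
      ((List.finRange n).map fun p => (cliffordModel (podd := podd) k μ).X (g p) ^ a p).prod := by
  let F := FractionRing (MvPolynomial (Fin n) k)
  choose ε hε using fun a =>
    cliffordModel_prod_apply (podd := podd) k μ g a (List.finRange n) 1
  let ev : Module.End F ((ℕ → ℤˣ) → F) →ₗ[k] F :=
    { toFun := fun A => A 1 1
      map_add' := fun A B => rfl
      map_smul' := fun c A => rfl }
  apply LinearIndependent.of_comp ev
  have h1 := ((linearIndependent_X_monomials k g).map_injOn
    (IsScalarTower.toAlgHom k (MvPolynomial (Fin n) k) F).toLinearMap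
    (IsFractionRing.injective (MvPolynomial (Fin n) k) F).injOn).units_smul
    fun a => Units.map (Int.castRingHom k).toMonoidHom (ε a)
  refine linearIndependent_of_eq h1 fun a => ?_
  refine (hε a).trans ?_
  simp [Units.smul_def, F, Int.cast_smul_eq_zsmul]

end CliffordModel

section LinearIndependence

variable {I podd n}

namespace StrandModel

variable {μ : Fin n → I} {F M : Type*} [CommRing F] [Ring M] [Algebra F M] [Algebra k F]
  [Algebra k M] [IsScalarTower k F M] (m : StrandModel podd μ F M) (t : Fin n → Fin n → F)

lemma isUnit_dC [Invertible (2 : k)] {p q : Fin n} (hpq : p ≠ q) : IsUnit (m.dC p q) := by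
  unfold dC
  split_ifs with h
  · have e : (m.C p - m.C q) * (m.C p - m.C q) = (2 : k) • (1 : M) := by
      simp only [mul_sub, sub_mul, m.C_mul_self p h.1, m.C_mul_self q h.2,
        m.C_mul_C p q hpq h.1 h.2]
      module
    refine isUnit_iff_exists.2 ⟨(⅟2 : k) • (m.C p - m.C q), ?_, ?_⟩
    · rw [mul_smul_comm, e, smul_smul, invOf_mul_self, one_smul]
    · rw [smul_mul_assoc, e, smul_smul, invOf_mul_self, one_smul]
  · exact isUnit_one

lemma tauOp_word_apply_eq_zero (l : List (Fin (n - 1))) {g : Equiv.Perm (Fin n)}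
    (hg : l.length ≤ inversions g) (hne : g ≠ (wordPerm l)⁻¹) :
    (l.map (m.tauOp k t)).prod (Pi.single 1 1) g = 0 := by
  induction l generalizing g with
  | nil =>
    have h : g ≠ 1 := by simpa using hne
    simp [Pi.single_eq_of_ne h]
  | cons a l ih =>
    rw [List.length_cons] at hg
    have hs : l.length ≤ inversions (g * sperm a) := by
      rcases lo_lt_or_gt g a with h | h
      · rw [inversions_mul_sperm_of_lt h]; omega
      · have := inversions_mul_sperm_of_gt h; omega
    rw [List.map_cons, List.prod_cons, Module.End.mul_apply, tauOp_apply, ih hs, ih (by omega)]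
    · simp
    · rintro rfl
      have := inversions_wordPerm_le l
      omega
    · intro h
      apply hne
      rw [wordPerm_cons, mul_inv_rev, sperm_inv, ← h, mul_sperm_mul_sperm]

lemma isUnit_tauOp_word_apply [Invertible (2 : k)] (ht : ∀ p q, q < p → t p q = 1)
    {l : List (Fin (n - 1))} (hl : Reduced l) :
    IsUnit ((l.map (m.tauOp k t)).prod (Pi.single 1 1) (wordPerm l)⁻¹) := by
  induction l with
  | nil => simp
  | cons a l ih =>
    have hd := hl.descent
    have h0 := inversions_wordPerm_le l
    have h1 : (wordPerm (a :: l))⁻¹ * sperm a = (wordPerm l)⁻¹ := by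
      rw [wordPerm_cons, mul_inv_rev, sperm_inv, mul_sperm_mul_sperm]
    rw [Reduced, List.length_cons] at hl
    rw [List.map_cons, List.prod_cons, Module.End.mul_apply, tauOp_apply, h1,
      m.tauOp_word_apply_eq_zero k t l (g := (wordPerm (a :: l))⁻¹) (by omega)
        (fun h => by rw [h] at hl; omega), mul_zero, add_zero, kap, ht _ _ hd, one_smul]
    exact (m.isUnit_dC k hd.ne').mul (ih (Reduced.tail (by rwa [Reduced, List.length_cons])))

lemma freeRep_pbw_apply (a : Fin n → ℕ) (l : List (Fin (n - 1))) (ν : Fin n → I)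
    (g : Equiv.Perm (Fin n)) :
    m.freeRep k t (((List.finRange n).map fun p => xF k I n p ^ a p).prod *
      (l.map (tauF k I n)).prod * eF k I n ν) (Pi.single 1 1) g =
    if μ = ν then ((List.finRange n).map fun p => m.X (g p) ^ a p).prod *
      (l.map (m.tauOp k t)).prod (Pi.single 1 1) g else 0 := by
  have he : m.eOp k ν (Pi.single 1 1) = if μ = ν then Pi.single 1 1 else 0 := by
    funext g
    rw [eOp_apply]
    by_cases hg : g = 1
    · subst hg
      by_cases h : μ = ν <;> simp [h]
    · by_cases h : μ = ν <;> simp [h, hg]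
  have hx (l : List (Fin n)) (f : Equiv.Perm (Fin n) → M) :
      (l.map fun p => m.xOp k p ^ a p).prod f g = (l.map fun p => m.X (g p) ^ a p).prod * f g := by
    induction l with
    | nil => simp
    | cons p l ih =>
      have hpow (b : ℕ) (f : Equiv.Perm (Fin n) → M) :
          (m.xOp k p ^ b) f g = m.X (g p) ^ b * f g := by
        induction b with
        | zero => simp
        | succ b hb => rw [pow_succ', Module.End.mul_apply, xOp_apply, hb, pow_succ', mul_assoc]
      rw [List.map_cons, List.prod_cons, Module.End.mul_apply, hpow, ih, List.map_cons,
        List.prod_cons, mul_assoc]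
  simp only [map_mul, map_list_prod, List.map_map, Function.comp_def, map_pow, freeRep_xF,
    freeRep_tauF, freeRep_eF, Module.End.mul_apply, he, hx]
  split_ifs <;> simp

end StrandModel

variable {k} {Qrep : I → I → FreeAlgebra k (Fin 2)}

/-- Evaluation at `g⁻¹` of the action of `R_n(Q)` on the strand model. -/
lemma exists_strand_functional [Invertible (2 : k)] (hQ : QConds k I podd Qrep)
    (red : Equiv.Perm (Fin n) → List (Fin (n - 1))) (hred : ∀ w, IsReducedWord n (red w) w)
    (μ : Fin n → I) (w : Equiv.Perm (Fin n)) :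
    ∃ (M : Type) (_ : Ring M) (_ : Algebra k M) (Φ : R k I podd n Qrep →ₗ[k] M)
      (v : (Fin n → ℕ) → M), LinearIndependent k v ∧
      (∀ a, Φ (pbwFamily k I podd n Qrep red (a, w, μ)) = v a) ∧
      (∀ a w', inversions w'⁻¹ ≤ inversions w⁻¹ → w' ≠ w →
        Φ (pbwFamily k I podd n Qrep red (a, w', μ)) = 0) ∧
      ∀ a w' ν, ν ≠ μ → Φ (pbwFamily k I podd n Qrep red (a, w', ν)) = 0 := by
  let m := cliffordModel (podd := podd) k μ
  obtain ⟨Qs, hsymm, hdiag, hev⟩ := m.exists_symmetric_scalars hQ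
  obtain ⟨t, ht, hc⟩ := m.exists_compatible (k := k) hsymm
  let ρ := RingQuot.liftAlgHom k ⟨m.freeRep k t, m.freeRep_rel t hsymm hdiag hev hc⟩
  have hρ (x : RFree k I n) : ρ (RingQuot.mkAlgHom k (RRel k I podd n Qrep) x) =
      m.freeRep k t x := RingQuot.liftAlgHom_mkAlgHom_apply ..
  have hpbw (a : Fin n → ℕ) (w' : Equiv.Perm (Fin n)) (ν : Fin n → I) :
      ρ (pbwFamily k I podd n Qrep red (a, w', ν)) = m.freeRep k t
        (((List.finRange n).map fun p => xF k I n p ^ a p).prod *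
          ((red w').map (tauF k I n)).prod * eF k I n ν) := by
    rw [← hρ]
    simp only [pbwFamily, xPow, tauProd, eR, xR, tauR, map_mul, map_list_prod, List.map_map,
      Function.comp_def, map_pow]
  let Φ := (LinearMap.proj (R := k) w⁻¹).comp
    ((LinearMap.applyₗ (R := k) (Pi.single (1 : Equiv.Perm (Fin n)) 1)).comp ρ.toLinearMap)
  have hΦ (a : Fin n → ℕ) (w' : Equiv.Perm (Fin n)) (ν : Fin n → I) :
      Φ (pbwFamily k I podd n Qrep red (a, w', ν)) = _ :=
    (congrArg (fun A => A (Pi.single 1 1) w⁻¹) (hpbw a w' ν)).trans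
      (m.freeRep_pbw_apply k t a (red w') ν w⁻¹)
  have hr (w') := (hred w').reduced
  have hunit := m.isUnit_tauOp_word_apply k t ht (hr w).2
  rw [(hr w).1] at hunit
  obtain ⟨y, hy⟩ := hunit
  refine ⟨_, inferInstance, inferInstance, Φ, _,
    (cliffordModel_linearIndependent (podd := podd) k μ w⁻¹).map' (LinearMap.mulRight k (y : _))
      (LinearMap.ker_eq_bot.2 y.isUnit.isRegular.right), fun a => ?_, fun a w' hw hne => ?_,
    fun a w' ν hν => ?_⟩
  · rw [hΦ, if_pos rfl, ← hy]
    rfl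
  · have hl := (hr w').2
    rw [Reduced, (hr w').1] at hl
    rw [hΦ, if_pos rfl, m.tauOp_word_apply_eq_zero k t (red w') (by rwa [← hl])
      (by rw [(hr w').1]; exact fun h => hne (inv_injective h).symm), mul_zero]
  · rw [hΦ, if_neg hν.symm]

lemma linearIndependent_pbwFamily [Invertible (2 : k)] (hQ : QConds k I podd Qrep)
    (red : Equiv.Perm (Fin n) → List (Fin (n - 1))) (hred : ∀ w, IsReducedWord n (red w) w) :
    LinearIndependent k (pbwFamily k I podd n Qrep red) := by
  classical
  refine linearIndependent_iff.2 fun c hc => ?_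
  by_contra hne
  obtain ⟨⟨a₀, w₀, μ⟩, h₀⟩ := Finsupp.ne_iff.1 hne
  obtain ⟨w, hw, hmax⟩ := (Finset.univ.filter fun w => ∃ a, c (a, w, μ) ≠ 0).exists_max_image
    (fun w : Equiv.Perm (Fin n) => inversions w⁻¹) ⟨w₀, by simpa using ⟨a₀, h₀⟩⟩
  obtain ⟨a₁, h₁⟩ := (Finset.mem_filter.1 hw).2
  obtain ⟨M, _, _, Φ, v, hv, hΦv, hΦ0, hΦν⟩ := exists_strand_functional hQ red hred μ w
  have hinj : Function.Injective fun a : Fin n → ℕ => (a, w, μ) := fun a b h => congrArg Prod.fst h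
  have hsum : Finsupp.linearCombination k v (c.comapDomain (fun a => (a, w, μ)) hinj.injOn) = 0 := by
    rw [← map_zero Φ, ← hc, Finsupp.linearCombination_apply, Finsupp.linearCombination_apply,
      Finsupp.sum, Finsupp.sum, map_sum]
    refine Finset.sum_of_injOn (fun a => (a, w, μ)) hinj.injOn (fun a ha => ?_) ?_ fun a _ => ?_
    · simpa using ha
    · rintro ⟨a, w', ν⟩ hs himg
      rw [map_smul]
      by_cases hν : ν = μ
      · subst hν
        have hw' : w' ≠ w := by
          rintro rfl
          exact himg ⟨a, by simpa using hs, rfl⟩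
        rw [hΦ0 a w' (hmax w' (by simpa using ⟨a, by simpa using hs⟩)) hw', smul_zero]
      · rw [hΦν a w' ν hν, smul_zero]
    · simp [hΦv]
  have := DFunLike.congr_fun (linearIndependent_iff.1 hv _ hsum) a₁
  exact h₁ (by simpa using this)

end LinearIndependence

theorem pbw_basis [Invertible (2 : k)]
    (Qrep : I → I → FreeAlgebra k (Fin 2)) (hQ : QConds k I podd Qrep)
    (red : Equiv.Perm (Fin n) → List (Fin (n - 1)))
    (hred : ∀ w, IsReducedWord n (red w) w) :
    LinearIndependent k (pbwFamily k I podd n Qrep red) ∧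
      Submodule.span k (Set.range (pbwFamily k I podd n Qrep red)) = ⊤ :=
  ⟨linearIndependent_pbwFamily hQ red hred,
    span_pbw_eq_top (φ := RingQuot.mkAlgHom k (RRel k I podd n Qrep))
      (fun _ _ h => RingQuot.mkAlgHom_rel k h) hQ (RingQuot.mkAlgHom_surjective k _) red hred⟩

end QuiverHeckeSuper10
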